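/- Let d ≥ 1 and let L be a linear functional on the real polynomial algebra ℝ[x₁,…,x_d] such that L(p²) ≥ 0 and L(x_j·p²) ≥ 0 for all p ∈ ℝ[x₁,…,x_d] and all j = 1,…,d, and such that for each j = 1,…,d the series Σ_{n=1}^∞ L(x_jⁿ)^{-1/(2n)} diverges to +∞. Then L is a Stieltjes moment functional: there exists a measure μ on ℝ^d supported on the closed orthant [0,∞)^d such that every polynomial is μ-integrable and L(p) = ∫ p dμ for all p ∈ ℝ[x₁,…,x_d]; moreover this representing measure is unique, i.e., any two measures on ℝ^d with respect to which all polynomials are integrable and which represent L in this way are equal. -/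

import Mathlib

open MeasureTheory MvPolynomial

/-- A qualitative form of Carleman's inequality: the geometric means of a summable nonnegative
sequence are summable. -/
theorem summable_geom_mean {a : ℕ → ℝ} (ha : ∀ k, 0 ≤ a k) (hs : Summable a) :
    Summable fun n : ℕ => (∏ k ∈ Finset.range (n + 1), a k) ^ ((1 : ℝ) / (n + 1)) := by
  have bound : ∀ n : ℕ, (∏ k ∈ Finset.range (n + 1), a k) ^ ((1 : ℝ) / (n + 1)) ≤
      ∑ k ∈ Finset.range (n + 1), Real.exp 1 * (((n + 1 : ℕ) : ℝ) ^ 2)⁻¹ * ((k + 1) * a k) := by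
    intro n
    have hN : (0 : ℝ) < n + 1 := by positivity
    have hz : ∀ k ∈ Finset.range (n + 1), 0 ≤ ((k : ℝ) + 1) * a k :=
      fun k _ => mul_nonneg (by positivity) (ha k)
    have amgm := Real.geom_mean_le_arith_mean_weighted (Finset.range (n + 1))
      (fun _ => (1 : ℝ) / (n + 1)) (fun k => ((k : ℝ) + 1) * a k) (fun _ _ => by positivity)
      (by simp; field_simp) hz
    rw [Real.finsetProd_rpow _ _ hz, Finset.prod_mul_distrib, ← Finset.mul_sum] at amgm
    have hfac : ∏ k ∈ Finset.range (n + 1), ((k : ℝ) + 1) = ((n + 1).factorial : ℝ) := by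
      rw [← Finset.prod_range_add_one_eq_factorial]; push_cast; rfl
    have hP : 0 ≤ ∏ k ∈ Finset.range (n + 1), a k := Finset.prod_nonneg fun k _ => ha k
    rw [hfac, Real.mul_rpow (by positivity) hP] at amgm
    have hfle : ((n : ℝ) + 1) / Real.exp 1 ≤ ((n + 1).factorial : ℝ) ^ ((1 : ℝ) / (n + 1)) := by
      have h1 := Real.pow_div_factorial_le_exp ((n : ℝ) + 1) hN.le (n + 1)
      have h2 : (((n : ℝ) + 1) / Real.exp 1) ^ (n + 1) ≤ ((n + 1).factorial : ℝ) := by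
        rw [div_pow, div_le_iff₀ (by positivity), ← Real.exp_nat_mul]
        rw [div_le_iff₀ (by positivity)] at h1
        calc _ ≤ _ := h1
          _ = _ := by push_cast; ring_nf
      have h3 := Real.rpow_le_rpow (by positivity) h2 (z := (1 : ℝ) / (n + 1)) (by positivity)
      rwa [← Real.rpow_natCast, ← Real.rpow_mul (by positivity), Nat.cast_add, Nat.cast_one,
        mul_one_div_cancel hN.ne', Real.rpow_one] at h3
    have hG : 0 ≤ (∏ k ∈ Finset.range (n + 1), a k) ^ ((1 : ℝ) / (n + 1)) :=
      Real.rpow_nonneg hP _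
    have h4 := (mul_le_mul_of_nonneg_right hfle hG).trans amgm
    rw [← Finset.mul_sum]
    rw [div_mul_eq_mul_div, div_le_iff₀ (Real.exp_pos 1)] at h4
    exact le_of_mul_le_mul_left (h4.trans_eq (by push_cast; field_simp)) hN
  have hterm : ∀ n : ℕ, 0 ≤ (∏ k ∈ Finset.range (n + 1), a k) ^ ((1 : ℝ) / (n + 1)) :=
    fun n => Real.rpow_nonneg (Finset.prod_nonneg fun k _ => ha k) _
  refine summable_of_sum_range_le (c := 2 * Real.exp 1 * ∑' k, a k) hterm fun m => ?_
  refine (Finset.sum_le_sum fun n _ => bound n).trans ?_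
  rw [Finset.sum_comm' (t' := Finset.range m) (s' := fun k => Finset.Ico k m)
    (by intro x y; simp only [Finset.mem_range, Finset.mem_Ico]; omega)]
  have : ∀ k ∈ Finset.range m, ∑ n ∈ Finset.Ico k m,
      Real.exp 1 * (((n + 1 : ℕ) : ℝ) ^ 2)⁻¹ * ((k + 1) * a k) ≤ 2 * Real.exp 1 * a k := by
    intro k _
    rw [← Finset.sum_mul, ← Finset.mul_sum]
    have h := sum_Ioo_inv_sq_le (α := ℝ) k (m + 1)
    have hI : Finset.Ioo k (m + 1) = Finset.Ico (k + 1) (m + 1) := by ext; simp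
    rw [hI, ← Finset.sum_Ico_add' (fun n : ℕ => ((n : ℝ) ^ 2)⁻¹)] at h
    have hk : (0 : ℝ) < k + 1 := by positivity
    rw [le_div_iff₀ hk] at h
    nlinarith [mul_le_mul_of_nonneg_right h (mul_nonneg (Real.exp_pos 1).le (ha k))]
  refine (Finset.sum_le_sum this).trans ?_
  rw [← Finset.mul_sum]
  exact mul_le_mul_of_nonneg_left (hs.sum_le_tsum _ fun k _ => ha k) (by positivity)

/-- If two coupled positive recurrences have a square-summable solution, then the ratios of the
weights are summable after taking fourth roots. -/
theorem summable_ratio_of_recurrence {g h α κ : ℕ → ℝ} {δ : ℝ} (hδ : 0 < δ)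
    (hg : ∀ k, 0 < g k) (hh : ∀ k, 0 < h k) (h0 : α 0 = 1) (h0' : κ 0 = 1)
    (hα : ∀ k, α (k + 1) = δ * κ k + h k / g k * α k)
    (hκ : ∀ k, κ (k + 1) = α (k + 1) + g (k + 1) / h k * κ k)
    (hE : Summable fun k => α k ^ 2 / g k) :
    Summable fun k => √(√(g k / g (k + 1))) := by
  have hpos : ∀ k, 0 < α k ∧ 0 < κ k := by
    intro k
    induction k with
    | zero => simp [h0, h0']
    | succ k ih =>
      obtain ⟨ha, hb⟩ := ih
      have h1 : 0 < α (k + 1) := by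
        rw [hα]; have := div_pos (hh k) (hg k); positivity
      refine ⟨h1, ?_⟩
      rw [hκ]; have := div_pos (hg (k + 1)) (hh k); positivity
  have hαp := fun k => (hpos k).1
  have hκp := fun k => (hpos k).2
  have tel : ∀ n, ∑ k ∈ Finset.range n, δ * g k / (α k * α (k + 1)) ≤
      g 0 - g n / (α n * κ n) := by
    intro n
    induction n with
    | zero => simp [h0, h0']
    | succ n ih =>
      rw [Finset.sum_range_succ]
      have e1 : δ * g n / (α n * α (n + 1)) = g n / (α n * κ n) - h n / (α (n + 1) * κ n) := by
        have := hα n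
        have := hg n; have := hh n; have := hαp n; have := hαp (n + 1); have := hκp n
        field_simp
        field_simp at *
        linarith
      have e2 : g (n + 1) / (α (n + 1) * κ (n + 1)) ≤ h n / (α (n + 1) * κ n) := by
        have := hκ n
        have := hg (n + 1); have := hh n; have := hαp (n + 1); have := hκp (n + 1)
        have := hκp n
        rw [div_le_div_iff₀ (by positivity) (by positivity)]
        have e3 : h n * κ (n + 1) = h n * α (n + 1) + g (n + 1) * κ n := by
          rw [hκ]; field_simp
        have : h n * (α (n + 1) * κ (n + 1)) = α (n + 1) * (h n * κ (n + 1)) := by ring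
        rw [this, e3]
        have : 0 < α (n + 1) * (h n * α (n + 1)) := by positivity
        nlinarith
      linarith
  have hsum1 : Summable fun k => δ * g k / (α k * α (k + 1)) := by
    refine summable_of_sum_range_le (c := g 0) (fun k => ?_) fun n => (tel n).trans ?_
    · have := hg k; have := hαp k; have := hαp (k + 1); positivity
    · have := hg n; have := hαp n; have := hκp n
      have : 0 < g n / (α n * κ n) := by positivity
      linarith
  have hE' := (summable_nat_add_iff 1).2 hE
  refine Summable.of_nonneg_of_le (fun k => by positivity) (fun k => ?_)
    ((hE.add hE').add (hsum1.mul_left (1 / δ)))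
  have p1 := hg k; have p2 := hg (k + 1); have p3 := hαp k; have p4 := hαp (k + 1)
  set u := √(g k) with hu
  set v := √(g (k + 1)) with hv
  have hu0 : 0 < u := Real.sqrt_pos.2 p1
  have hv0 : 0 < v := Real.sqrt_pos.2 p2
  have hu2 : g k = u ^ 2 := (Real.sq_sqrt p1.le).symm
  have hv2 : g (k + 1) = v ^ 2 := (Real.sq_sqrt p2.le).symm
  rw [Real.sqrt_div' _ p2.le, ← hu, ← hv, hu2, hv2]
  apply Real.sqrt_le_iff.2
  constructor
  · positivity
  set x := α k / u with hx
  set y := α (k + 1) / v with hy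
  have hx0 : 0 < x := by positivity
  have hy0 : 0 < y := by positivity
  set z := u / v with hz
  have hz0 : 0 < z := by positivity
  have e1 : α k ^ 2 / u ^ 2 = x ^ 2 := by rw [hx]; field_simp
  have e2 : α (k + 1) ^ 2 / v ^ 2 = y ^ 2 := by rw [hy]; field_simp
  have e3 : 1 / δ * (δ * u ^ 2 / (α k * α (k + 1))) = z / (x * y) := by
    rw [hx, hy, hz]; field_simp
  rw [e1, e2, e3]
  have hw0 : 0 < z / (x * y) := by positivity
  have : z = (z / (x * y)) * (x * y) := by field_simp
  have h6 : x * y ≤ x ^ 2 + y ^ 2 := by nlinarith [sq_nonneg (x - y)]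
  have h7 : z ≤ (z / (x * y)) * (x ^ 2 + y ^ 2) := by
    calc z = (z / (x * y)) * (x * y) := this
      _ ≤ _ := by gcongr
  nlinarith [sq_nonneg (x ^ 2 + y ^ 2 - z / (x * y)), sq_nonneg (x ^ 2 + y ^ 2),
    sq_nonneg (z / (x * y))]

/-- The two coupled sequences of monic orthogonal polynomials attached to a functional `M`:
the first one is orthogonal for `M`, the second one for `p ↦ M (X * p)`. -/
noncomputable def stieltjesPair (M : Polynomial ℝ →ₗ[ℝ] ℝ) : ℕ → Polynomial ℝ × Polynomial ℝ
  | 0 => (1, 1)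
  | k + 1 =>
    let A := (stieltjesPair M k).1
    let B := (stieltjesPair M k).2
    let A' := Polynomial.X * B - Polynomial.C (M (Polynomial.X * B ^ 2) / M (A ^ 2)) * A
    (A', A' - Polynomial.C (M (A' ^ 2) / M (Polynomial.X * B ^ 2)) * B)

/-- The coefficients of `p` of index at least `k` are those of `X ^ k`. -/
def MonicOfOrder (k : ℕ) (p : Polynomial ℝ) : Prop :=
  ∀ m, k ≤ m → p.coeff m = if m = k then 1 else 0

/-- The polynomial `q` has degree less than `k`. -/
def OrderLT (k : ℕ) (q : Polynomial ℝ) : Prop :=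
  ∀ m, k ≤ m → q.coeff m = 0

theorem MonicOfOrder.ne_zero {k : ℕ} {p : Polynomial ℝ} (h : MonicOfOrder k p) : p ≠ 0 := by
  rintro rfl
  simpa using h k le_rfl

theorem MonicOfOrder.sub_orderLT {k : ℕ} {p q : Polynomial ℝ} (hp : MonicOfOrder k p)
    (hq : MonicOfOrder k q) : OrderLT k (p - q) := by
  intro m hm
  simp [hp m hm, hq m hm]

theorem MonicOfOrder.orderLT_succ {k : ℕ} {p : Polynomial ℝ} (hp : MonicOfOrder k p) :
    OrderLT (k + 1) p := by
  intro m hm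
  rw [hp m (by omega), if_neg (by omega)]

theorem MonicOfOrder.sub_C_mul {k : ℕ} {p q : Polynomial ℝ} (hp : MonicOfOrder k p) (c : ℝ)
    (hq : OrderLT k q) : MonicOfOrder k (p - Polynomial.C c * q) := by
  intro m hm
  simp [hp m hm, hq m hm]

theorem MonicOfOrder.X_mul {k : ℕ} {p : Polynomial ℝ} (hp : MonicOfOrder k p) :
    MonicOfOrder (k + 1) (Polynomial.X * p) := by
  intro m hm
  obtain ⟨n, rfl⟩ : ∃ n, m = n + 1 := ⟨m - 1, by omega⟩
  rw [Polynomial.coeff_X_mul, hp n (by omega)]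
  simp

theorem OrderLT.X_mul {k : ℕ} {q : Polynomial ℝ} (hq : OrderLT k q) :
    OrderLT (k + 1) (Polynomial.X * q) := by
  intro m hm
  obtain ⟨n, rfl⟩ : ∃ n, m = n + 1 := ⟨m - 1, by omega⟩
  rw [Polynomial.coeff_X_mul, hq n (by omega)]

theorem OrderLT.exists_eq_C_mul_add {k : ℕ} {p q : Polynomial ℝ} (hq : OrderLT (k + 1) q)
    (hp : MonicOfOrder k p) : ∃ c r, OrderLT k r ∧ q = Polynomial.C c * p + r := by
  refine ⟨q.coeff k, q - Polynomial.C (q.coeff k) * p, fun m hm => ?_, by ring⟩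
  rw [Polynomial.coeff_sub, Polynomial.coeff_C_mul, hp m hm]
  rcases hm.eq_or_lt with rfl | h
  · simp
  · rw [hq m h, if_neg (by omega)]; simp

theorem LinearMap.map_polynomial_C_mul (M : Polynomial ℝ →ₗ[ℝ] ℝ) (c : ℝ) (p : Polynomial ℝ) :
    M (Polynomial.C c * p) = c * M p := by
  rw [← Polynomial.smul_eq_C_mul, map_smul, smul_eq_mul]

theorem stieltjesPair_spec {M : Polynomial ℝ →ₗ[ℝ] ℝ} (hM : ∀ p, p ≠ 0 → 0 < M (p ^ 2))
    (hX : ∀ p, p ≠ 0 → 0 < M (Polynomial.X * p ^ 2)) (k : ℕ) :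
    MonicOfOrder k (stieltjesPair M k).1 ∧ MonicOfOrder k (stieltjesPair M k).2 ∧
      (∀ q, OrderLT k q → M ((stieltjesPair M k).1 * q) = 0) ∧
      (∀ q, OrderLT k q → M (Polynomial.X * (stieltjesPair M k).2 * q) = 0) := by
  induction k with
  | zero =>
    have hzero : ∀ q : Polynomial ℝ, OrderLT 0 q → q = 0 := fun q hq => by
      ext m; simpa using hq m (Nat.zero_le m)
    have hone : MonicOfOrder 0 (1 : Polynomial ℝ) := fun m _ => by
      simp [Polynomial.coeff_one]
    refine ⟨hone, hone, fun q hq => ?_, fun q hq => ?_⟩ <;> simp [hzero q hq]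
  | succ k ih =>
    obtain ⟨hA, hB, oA, oB⟩ := ih
    simp only [stieltjesPair]
    set A := (stieltjesPair M k).1
    set B := (stieltjesPair M k).2
    set A' := Polynomial.X * B - Polynomial.C (M (Polynomial.X * B ^ 2) / M (A ^ 2)) * A with hA'
    have mA' : MonicOfOrder (k + 1) A' := hB.X_mul.sub_C_mul _ hA.orderLT_succ
    have oA' : ∀ q, OrderLT (k + 1) q → M (A' * q) = 0 := by
      intro q hq
      obtain ⟨c, r, hr, rfl⟩ := hq.exists_eq_C_mul_add hA
      have h1 : M (Polynomial.X * B * A) = M (Polynomial.X * B ^ 2) := by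
        have := oB _ (hA.sub_orderLT hB)
        rw [mul_sub, map_sub, sub_eq_zero] at this
        rw [this]; ring_nf
      have h2 : A' * (Polynomial.C c * A + r) =
          Polynomial.C c * (Polynomial.X * B * A) + Polynomial.X * B * r -
          Polynomial.C (M (Polynomial.X * B ^ 2) / M (A ^ 2)) *
            (Polynomial.C c * A ^ 2 + A * r) := by rw [hA']; ring
      have h3 := (hM A hA.ne_zero).ne'
      simp only [h2, map_add, map_sub, M.map_polynomial_C_mul, oA r hr, oB r hr, h1]
      field_simp
      ring
    refine ⟨mA', mA'.sub_C_mul _ hB.orderLT_succ, oA', fun q hq => ?_⟩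
    obtain ⟨c, r, hr, rfl⟩ := hq.exists_eq_C_mul_add hB
    have h1 : M (A' * (Polynomial.X * B)) = M (A' ^ 2) := by
      have := oA' _ (hB.X_mul.sub_orderLT mA')
      rw [mul_sub, map_sub, sub_eq_zero] at this
      rw [this]; ring_nf
    have h2 : Polynomial.X * (A' - Polynomial.C (M (A' ^ 2) / M (Polynomial.X * B ^ 2)) * B) *
        (Polynomial.C c * B + r) = Polynomial.C c * (A' * (Polynomial.X * B)) +
          A' * (Polynomial.X * r) - Polynomial.C (M (A' ^ 2) / M (Polynomial.X * B ^ 2)) *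
            (Polynomial.C c * (Polynomial.X * B ^ 2) + Polynomial.X * B * r) := by ring
    have h3 := (hX B hB.ne_zero).ne'
    simp only [h2, map_add, map_sub, M.map_polynomial_C_mul, oA' _ hr.X_mul, oB r hr, h1]
    field_simp
    ring

/-- The Cauchy-Schwarz inequality for a functional which is nonnegative on squares. -/
theorem cauchy_schwarz_of_sq_nonneg {A : Type*} [CommRing A] [Algebra ℝ A] (M : A →ₗ[ℝ] ℝ)
    (h : ∀ p, 0 ≤ M (p ^ 2)) (p q : A) : M (p * q) ^ 2 ≤ M (p ^ 2) * M (q ^ 2) := by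
  have key : ∀ t : ℝ, 0 ≤ M (q ^ 2) * (t * t) + 2 * M (p * q) * t + M (p ^ 2) := by
    intro t
    have e : (p + t • q) ^ 2 = (t * t) • q ^ 2 + (2 * t) • (p * q) + p ^ 2 := by
      simp only [Algebra.smul_def, map_mul, map_ofNat]; ring
    have := h (p + t • q)
    rw [e] at this
    simp only [map_add, map_smul, smul_eq_mul] at this
    linarith
  have := discrim_le_zero key
  rw [discrim] at this
  linarith

/-- The value at `-τ` of the `k`-th orthogonal polynomial of the pair, with a sign making it
positive for `τ ≥ 0`. -/
theorem stieltjesPair_eval_mono {M : Polynomial ℝ →ₗ[ℝ] ℝ} (hM : ∀ p, p ≠ 0 → 0 < M (p ^ 2))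
    (hX : ∀ p, p ≠ 0 → 0 < M (Polynomial.X * p ^ 2)) {δ τ : ℝ} (hδ : 0 ≤ δ) (h : δ ≤ τ) (k : ℕ) :
    (0 ≤ (-1) ^ k * (stieltjesPair M k).1.eval (-δ) ∧
      (-1) ^ k * (stieltjesPair M k).1.eval (-δ) ≤ (-1) ^ k * (stieltjesPair M k).1.eval (-τ)) ∧
    (0 ≤ (-1) ^ k * (stieltjesPair M k).2.eval (-δ) ∧
      (-1) ^ k * (stieltjesPair M k).2.eval (-δ) ≤
        (-1) ^ k * (stieltjesPair M k).2.eval (-τ)) := by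
  induction k with
  | zero => simp [stieltjesPair]
  | succ k ih =>
    obtain ⟨hA, hB, -, -⟩ := stieltjesPair_spec hM hX k
    obtain ⟨mA', -, -, -⟩ := stieltjesPair_spec hM hX (k + 1)
    have g1 := hM _ hA.ne_zero
    have g2 := hX _ hB.ne_zero
    have g3 := hM _ mA'.ne_zero
    simp only [stieltjesPair] at g3 ⊢
    set A := (stieltjesPair M k).1
    set B := (stieltjesPair M k).2
    set β := M (Polynomial.X * B ^ 2) / M (A ^ 2)
    set γ := M ((Polynomial.X * B - Polynomial.C β * A) ^ 2) / M (Polynomial.X * B ^ 2)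
    have hβ : 0 < β := div_pos g2 g1
    have hγ : 0 < γ := div_pos g3 g2
    simp only [Polynomial.eval_sub, Polynomial.eval_mul, Polynomial.eval_X, Polynomial.eval_C]
    obtain ⟨⟨a1, a2⟩, b1, b2⟩ := ih
    have e1 : ∀ s : ℝ, (-1) ^ (k + 1) * (-s * B.eval (-s) - β * A.eval (-s)) =
      s * ((-1) ^ k * B.eval (-s)) + β * ((-1) ^ k * A.eval (-s)) := fun s => by ring
    have e2 : ∀ s : ℝ, (-1) ^ (k + 1) * (-s * B.eval (-s) - β * A.eval (-s) - γ * B.eval (-s)) =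
      s * ((-1) ^ k * B.eval (-s)) + β * ((-1) ^ k * A.eval (-s)) +
        γ * ((-1) ^ k * B.eval (-s)) := fun s => by ring
    rw [e1, e1, e2, e2]
    have c1 := mul_le_mul h b2 b1 (hδ.trans h)
    have c2 := mul_le_mul_of_nonneg_left a2 hβ.le
    have c3 := mul_le_mul_of_nonneg_left b2 hγ.le
    exact ⟨⟨by positivity, by linarith⟩, by positivity, by linarith⟩

theorem min_one_le_rpow {x e : ℝ} (hx : 0 < x) (he : 0 ≤ e) (he' : e ≤ 1) : min 1 x ≤ x ^ e := by
  rcases le_total 1 x with h | h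
  · exact (min_le_left _ _).trans (Real.one_le_rpow h he)
  · refine (min_le_right _ _).trans ?_
    simpa using Real.rpow_le_rpow_of_exponent_ge hx h he'

/-- Under the Carleman type condition of Stieltjes, a strictly positive functional has arbitrarily
small polynomials which are at least one on a negative half-line. -/
theorem exists_small_of_not_summable {M : Polynomial ℝ →ₗ[ℝ] ℝ}
    (hM : ∀ p, p ≠ 0 → 0 < M (p ^ 2)) (hX : ∀ p, p ≠ 0 → 0 < M (Polynomial.X * p ^ 2))
    (hC : ¬ Summable fun n : ℕ =>
      (M (Polynomial.X ^ (2 * (n + 1)))) ^ (-(1 / (4 * ((n : ℝ) + 1)))))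
    {δ ε : ℝ} (hδ : 0 < δ) (hε : 0 < ε) :
    ∃ g : Polynomial ℝ, g.eval (-δ) = 1 ∧ (∀ t ≤ -δ, 1 ≤ g.eval t) ∧ M (g ^ 2) ≤ ε := by
  have spec := stieltjesPair_spec hM hX
  set A := fun k => (stieltjesPair M k).1 with hA
  set B := fun k => (stieltjesPair M k).2 with hB
  set g := fun k => M (A k ^ 2) with hg
  set α := fun k => (-1) ^ k * (A k).eval (-δ) with hα
  set κ := fun k => (-1) ^ k * (B k).eval (-δ) with hκ
  have gpos : ∀ k, 0 < g k := fun k => hM _ (spec k).1.ne_zero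
  have ortho : ∀ k l, k < l → M (A l * A k) = 0 := by
    intro k l hkl
    refine (spec l).2.2.1 _ fun m hm => ?_
    rw [(spec k).1 m (by omega), if_neg (by omega)]
  have hE : ¬ Summable fun k => α k ^ 2 / g k := by
    intro hE
    have hs := summable_ratio_of_recurrence (g := g)
      (h := fun k => M (Polynomial.X * B k ^ 2)) (α := α) (κ := κ) hδ gpos
      (fun k => hX _ (spec k).2.1.ne_zero) (by simp [hα, hA, stieltjesPair])
      (by simp [hκ, hB, stieltjesPair])
      (fun k => by simp only [hα, hκ, hg, hA, hB, stieltjesPair]; simp; ring)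
      (fun k => by simp only [hα, hκ, hg, hA, hB, stieltjesPair]; simp; ring) hE
    have hs' := summable_geom_mean (fun k => by positivity) hs
    have hprod : ∀ n, ∏ k ∈ Finset.range n, √(√(g k / g (k + 1))) = √(√(g 0 / g n)) := by
      intro n
      induction n with
      | zero => simp [(gpos 0).ne']
      | succ n ih =>
        have := gpos 0; have := gpos n; have := gpos (n + 1)
        rw [Finset.prod_range_succ, ih, ← Real.sqrt_mul (by positivity),
          ← Real.sqrt_mul (by positivity)]
        congr 2
        field_simp
    simp only [hprod] at hs'
    refine hC (Summable.of_nonneg_of_le (fun n => ?_) (fun n => ?_)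
      (hs'.mul_left (min 1 (g 0))⁻¹))
    · refine Real.rpow_nonneg ?_ _
      rw [mul_comm, pow_mul]; exact (hM _ (pow_ne_zero _ Polynomial.X_ne_zero)).le
    · set m := M (Polynomial.X ^ (2 * (n + 1))) with hm
      have g0 := gpos 0
      have gn := gpos (n + 1)
      have hgm : g (n + 1) ≤ m := by
        have mX : MonicOfOrder (n + 1) (Polynomial.X ^ (n + 1) : Polynomial ℝ) := fun m _ => by
          simp [Polynomial.coeff_X_pow]
        have h1 : M (A (n + 1) * Polynomial.X ^ (n + 1)) = g (n + 1) := by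
          have := (spec (n + 1)).2.2.1 _ (mX.sub_orderLT (spec (n + 1)).1)
          rw [mul_sub, map_sub, sub_eq_zero] at this
          rw [this, ← pow_two]
        have h2 := cauchy_schwarz_of_sq_nonneg M (fun p => by
          rcases eq_or_ne p 0 with rfl | hp
          · simp
          · exact (hM p hp).le) (A (n + 1)) (Polynomial.X ^ (n + 1))
        rw [h1, ← pow_mul, mul_comm (n + 1) 2, ← hm, pow_two] at h2
        exact le_of_mul_le_mul_left h2 gn
      have hmpos : 0 < m := gn.trans_le hgm
      have hn : (0 : ℝ) < 4 * ((n : ℝ) + 1) := by positivity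
      have e1 : √(√(g 0 / g (n + 1))) ^ ((1 : ℝ) / (n + 1)) =
          g 0 ^ (1 / (4 * ((n : ℝ) + 1))) * g (n + 1) ^ (-(1 / (4 * ((n : ℝ) + 1)))) := by
        rw [Real.rpow_neg gn.le, ← div_eq_mul_inv, ← Real.div_rpow g0.le gn.le,
          Real.sqrt_eq_rpow, Real.sqrt_eq_rpow, ← Real.rpow_mul (by positivity),
          ← Real.rpow_mul (by positivity)]
        congr 1
        field_simp
        norm_num
      rw [e1, inv_mul_eq_div, le_div_iff₀ (by positivity), mul_comm]
      refine mul_le_mul (min_one_le_rpow g0 (by positivity) ?_) ?_ (by positivity) (by positivity)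
      · rw [div_le_one hn]; nlinarith [(Nat.cast_nonneg n : (0 : ℝ) ≤ n)]
      · exact Real.rpow_le_rpow_of_nonpos gn hgm (by simp; positivity)
  have hEnn : ∀ k, 0 ≤ α k ^ 2 / g k := fun k => div_nonneg (sq_nonneg _) (gpos k).le
  rw [not_summable_iff_tendsto_nat_atTop_of_nonneg hEnn] at hE
  obtain ⟨N, hN⟩ := (hE.eventually_ge_atTop (1 / ε)).exists
  set S := ∑ k ∈ Finset.range N, α k ^ 2 / g k with hS
  have hSpos : 0 < S := (by positivity : 0 < 1 / ε).trans_le hN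
  set P : ℕ → Polynomial ℝ := fun n =>
    ∑ k ∈ Finset.range n, Polynomial.C ((-1) ^ k * α k / g k) * A k with hP
  have hPeval : ∀ t n, (P n).eval t =
      ∑ k ∈ Finset.range n, α k * ((-1) ^ k * (A k).eval t) / g k := by
    intro t n
    simp only [hP, Polynomial.eval_finsetSum, Polynomial.eval_mul, Polynomial.eval_C]
    refine Finset.sum_congr rfl fun k _ => by ring
  have hPsq : ∀ n, (∀ l, n ≤ l → M (A l * P n) = 0) ∧
      M (P n ^ 2) = ∑ k ∈ Finset.range n, α k ^ 2 / g k := by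
    intro n
    have horth : ∀ n l, n ≤ l → M (A l * P n) = 0 := by
      intro n l hl
      simp only [hP, Finset.mul_sum, map_sum]
      refine Finset.sum_eq_zero fun k hk => ?_
      rw [mul_left_comm, M.map_polynomial_C_mul, ortho k l (by simp at hk; omega), mul_zero]
    refine ⟨horth n, ?_⟩
    induction n with
    | zero => simp [hP]
    | succ n ih =>
      have e : P (n + 1) = P n + Polynomial.C ((-1) ^ n * α n / g n) * A n :=
        Finset.sum_range_succ _ _
      have e' : P (n + 1) ^ 2 = P n ^ 2 + Polynomial.C (2 * ((-1) ^ n * α n / g n)) * (A n * P n) +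
          Polynomial.C (((-1) ^ n * α n / g n) ^ 2) * A n ^ 2 := by
        rw [e, map_pow, map_mul, map_ofNat]; ring
      rw [e', map_add, map_add, M.map_polynomial_C_mul, M.map_polynomial_C_mul, horth n n le_rfl,
        ih, Finset.sum_range_succ]
      have hgn := (gpos n).ne'
      change _ + ((-1) ^ n * α n / g n) ^ 2 * g n = _
      have : ((-1 : ℝ) ^ n) ^ 2 = 1 := by rw [← pow_mul, mul_comm, pow_mul]; simp
      field_simp
      rw [this]; ring
  refine ⟨Polynomial.C S⁻¹ * P N, ?_, fun t ht => ?_, ?_⟩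
  · rw [Polynomial.eval_mul, Polynomial.eval_C, hPeval]
    have : ∑ k ∈ Finset.range N, α k * ((-1) ^ k * (A k).eval (-δ)) / g k = S :=
      Finset.sum_congr rfl fun k _ => by rw [pow_two]
    rw [this, inv_mul_cancel₀ hSpos.ne']
  · rw [Polynomial.eval_mul, Polynomial.eval_C, hPeval, inv_mul_eq_div, one_le_div hSpos]
    refine Finset.sum_le_sum fun k _ => ?_
    have := (stieltjesPair_eval_mono hM hX hδ.le (le_neg.1 ht) k).1
    rw [neg_neg] at this
    rw [pow_two]
    exact div_le_div_of_nonneg_right (mul_le_mul_of_nonneg_left this.2 this.1) (gpos k).le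
  · rw [mul_pow, ← Polynomial.C_pow, M.map_polynomial_C_mul, (hPsq N).2, ← hS]
    rw [one_div, inv_le_comm₀ hε hSpos] at hN
    calc S⁻¹ ^ 2 * S = S⁻¹ := by field_simp
      _ ≤ ε := hN

theorem rpow_le_max_one {x e : ℝ} (hx : 0 < x) (he : 0 ≤ e) (he' : e ≤ 1) : x ^ e ≤ max 1 x := by
  rcases le_total 1 x with h | h
  · refine le_trans ?_ (le_max_right _ _)
    simpa using Real.rpow_le_rpow_of_exponent_le h he'
  · exact (Real.rpow_le_one hx.le h he).trans (le_max_left _ _)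

/-- For a positive log-convex sequence normalized by `m 0`, the roots `(m k / m 0) ^ (-1 / (2 k))`
are antitone. -/
theorem logConvex_root_antitone {m : ℕ → ℝ} (hpos : ∀ k, 0 < m k)
    (hlog : ∀ k, m (k + 1) ^ 2 ≤ m k * m (k + 2)) {j k : ℕ} (hj : 0 < j) (hjk : j ≤ k) :
    (m k / m 0) ^ (-(1 / (2 * (k : ℝ)))) ≤ (m j / m 0) ^ (-(1 / (2 * (j : ℝ)))) := by
  have h0 := hpos 0
  have step : ∀ k, m k ^ (k + 1) ≤ m 0 * m (k + 1) ^ k := by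
    intro k
    induction k with
    | zero => simp
    | succ k ih =>
      have h1 := hpos k; have h2 := hpos (k + 1); have h3 := hpos (k + 2)
      have h4 : (m (k + 1) ^ 2) ^ (k + 1) ≤ (m k * m (k + 2)) ^ (k + 1) :=
        pow_le_pow_left₀ (by positivity) (hlog k) _
      rw [mul_pow] at h4
      have h5 := h4.trans (mul_le_mul_of_nonneg_right ih (by positivity))
      refine le_of_mul_le_mul_left (a := m (k + 1) ^ k) ?_ (by positivity)
      calc _ = (m (k + 1) ^ 2) ^ (k + 1) := by ring
        _ ≤ _ := h5
        _ = _ := by ring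
  induction k, hjk using Nat.le_induction with
  | base => exact le_rfl
  | succ k hk ih =>
    refine le_trans ?_ ih
    have hk0 : (0 : ℝ) < k := by exact_mod_cast hj.trans_le hk
    have h1 : 0 < m k / m 0 := div_pos (hpos k) h0
    have h2 : 0 < m (k + 1) / m 0 := div_pos (hpos (k + 1)) h0
    have h3 : (m k / m 0) ^ (k + 1) ≤ (m (k + 1) / m 0) ^ k := by
      rw [div_pow, div_pow, div_le_div_iff₀ (by positivity) (by positivity)]
      calc m k ^ (k + 1) * m 0 ^ k ≤ (m 0 * m (k + 1) ^ k) * m 0 ^ k := by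
            gcongr; exact step k
        _ = _ := by ring
    have h4 := Real.rpow_le_rpow_of_nonpos (z := -(1 / (2 * (k : ℝ) * (k + 1)))) (by positivity) h3
      (by rw [neg_nonpos]; positivity)
    rw [← Real.rpow_natCast, ← Real.rpow_natCast, ← Real.rpow_mul h1.le, ← Real.rpow_mul h2.le]
      at h4
    have e1 : ((k + 1 : ℕ) : ℝ) * -(1 / (2 * (k : ℝ) * (k + 1))) = -(1 / (2 * (k : ℝ))) := by
      push_cast; field_simp
    have e2 : (k : ℝ) * -(1 / (2 * (k : ℝ) * (k + 1))) = -(1 / (2 * ((k + 1 : ℕ) : ℝ))) := by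
      push_cast; field_simp
    rwa [e1, e2] at h4

/-- Divergence of the Stieltjes series of a log-convex sequence is inherited, along even indices,
by sequences dominated by the square roots of the terms of even index. -/
theorem not_summable_of_stieltjes {m m' : ℕ → ℝ} (hm : ∀ k, 0 ≤ m k)
    (hlog : ∀ k, m (k + 1) ^ 2 ≤ m k * m (k + 2))
    (hS : ∑' n : ℕ, (ENNReal.ofReal (m (n + 1))) ^ (-(1 / (2 * ((n : ℝ) + 1)))) = ⊤)
    (hm' : ∀ k, 0 < m' k) {C : ℝ} (hC : 1 ≤ C) (hle : ∀ k, m' k ≤ C * (√(m (2 * k)) + 1)) :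
    ¬ Summable fun n : ℕ => (m' (2 * (n + 1))) ^ (-(1 / (4 * ((n : ℝ) + 1)))) := by
  intro hs
  set r := fun n : ℕ => (m' (2 * (n + 1))) ^ (-(1 / (4 * ((n : ℝ) + 1)))) with hr
  have rpos : ∀ n, 0 < r n := fun n => Real.rpow_pos_of_pos (hm' _) _
  have hlarge : ∀ᶠ n : ℕ in Filter.atTop,
      (r n)⁻¹ ^ (8 * (n + 1)) ≤ 4 * C ^ 2 * m (4 * (n + 1)) := by
    filter_upwards [hs.tendsto_atTop_zero.eventually_lt_const
      (show (0 : ℝ) < 1 / (2 * C) by positivity)] with n hn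
    have h1 : 2 * C ≤ (r n)⁻¹ := by
      rw [one_div] at hn
      exact (le_inv_comm₀ (rpos n) (by positivity)).1 hn.le
    have h2 : m' (2 * (n + 1)) = (r n)⁻¹ ^ (4 * (n + 1)) := by
      rw [hr, ← Real.rpow_neg (hm' _).le, neg_neg, ← Real.rpow_natCast, ← Real.rpow_mul (hm' _).le]
      push_cast
      rw [one_div, inv_mul_cancel₀ (by positivity), Real.rpow_one]
    have h3 : 2 * C ≤ (r n)⁻¹ ^ (4 * (n + 1)) :=
      h1.trans (le_self_pow₀ (by linarith) (by omega))
    have h4 := hle (2 * (n + 1))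
    rw [h2, ← mul_assoc] at h4
    norm_num at h4
    set s := √(m (4 * (n + 1)))
    have hs0 : 0 ≤ s := Real.sqrt_nonneg _
    set t := (r n)⁻¹ ^ (4 * (n + 1))
    have h5 : t ≤ 2 * C * s := by
      have : (r n ^ (4 * (n + 1)))⁻¹ = t := by simp [t]
      rw [this] at h4
      linarith
    have h6 : m (4 * (n + 1)) = s ^ 2 := (Real.sq_sqrt (hm _)).symm
    have h7 : (r n)⁻¹ ^ (8 * (n + 1)) = t ^ 2 := by
      rw [← pow_mul]; congr 1; ring
    rw [h6, h7]
    have : 0 ≤ t := by linarith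
    calc t ^ 2 ≤ (2 * C * s) ^ 2 := by gcongr
      _ = _ := by ring
  have hpos : ∀ k, 0 < m k := by
    intro k
    refine lt_of_le_of_ne (hm k) fun h0 => ?_
    have hz : ∀ i, m (k + i) = 0 := by
      intro i
      induction i with
      | zero => exact h0.symm
      | succ i ih =>
        have := hlog (k + i)
        rw [ih, zero_mul] at this
        exact pow_eq_zero_iff two_ne_zero |>.1 (le_antisymm this (sq_nonneg _))
    obtain ⟨n, hn, hkn⟩ := (hlarge.and (Filter.eventually_ge_atTop k)).exists
    obtain ⟨i, hi⟩ := Nat.exists_eq_add_of_le (show k ≤ 4 * (n + 1) by omega)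
    rw [hi, hz i, mul_zero] at hn
    have := pow_pos (inv_pos.2 (rpos n)) (8 * (n + 1))
    linarith
  have h0 := hpos 0
  set F := fun k : ℕ => m k ^ (-(1 / (2 * (k : ℝ)))) with hF
  set K := max 1 (m 0)⁻¹ * (max 1 (m 0) * (4 * C ^ 2)) with hK
  have hbound : ∀ᶠ k : ℕ in Filter.atTop, ‖F (k + 4)‖ ≤ K * r (k / 4) := by
    obtain ⟨n₀, hn₀⟩ := Filter.eventually_atTop.1 hlarge
    filter_upwards [Filter.eventually_ge_atTop (4 * n₀)] with k hk
    set n := k / 4 with hn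
    have hb := hn₀ n (by omega)
    have hrn := rpos n
    have scale : ∀ i : ℕ, F i = (m 0) ^ (-(1 / (2 * (i : ℝ)))) *
        (m i / m 0) ^ (-(1 / (2 * (i : ℝ)))) := fun i => by
      rw [hF, ← Real.mul_rpow h0.le (div_pos (hpos i) h0).le]
      field_simp
    have exp_le : ∀ i : ℕ, 0 < i → 1 / (2 * (i : ℝ)) ≤ 1 := fun i hi => by
      have : (1 : ℝ) ≤ i := by exact_mod_cast hi
      rw [div_le_one (by positivity)]; linarith
    have hFnn : 0 ≤ F (k + 4) := Real.rpow_nonneg (hm _) _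
    rw [Real.norm_of_nonneg hFnn, scale]
    have e1 : m 0 ^ (-(1 / (2 * ((k + 4 : ℕ) : ℝ)))) ≤ max 1 (m 0)⁻¹ := by
      rw [Real.rpow_neg h0.le, ← Real.inv_rpow h0.le]
      exact rpow_le_max_one (inv_pos.2 h0) (by positivity) (exp_le _ (by omega))
    have e2 := logConvex_root_antitone hpos hlog (j := 4 * (n + 1)) (k := k + 4) (by omega)
      (by omega)
    have e3 : (m (4 * (n + 1)) / m 0) ^ (-(1 / (2 * ((4 * (n + 1) : ℕ) : ℝ)))) ≤
        max 1 (m 0) * F (4 * (n + 1)) := by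
      rw [Real.div_rpow (hm _) h0.le, div_eq_inv_mul, Real.rpow_neg h0.le, inv_inv]
      exact mul_le_mul_of_nonneg_right
        (rpow_le_max_one h0 (by positivity) (exp_le _ (by omega))) (Real.rpow_nonneg (hm _) _)
    have e4 : F (4 * (n + 1)) ≤ 4 * C ^ 2 * r n := by
      have hlow : (r n)⁻¹ ^ (8 * (n + 1)) / (4 * C ^ 2) ≤ m (4 * (n + 1)) := by
        rw [div_le_iff₀ (by positivity)]; linarith
      have h5 := Real.rpow_le_rpow_of_nonpos (z := -(1 / (2 * ((4 * (n + 1) : ℕ) : ℝ))))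
        (by positivity) hlow (by rw [neg_nonpos]; positivity)
      refine h5.trans ?_
      rw [Real.div_rpow (by positivity) (by positivity), Real.rpow_neg (by positivity),
        Real.rpow_neg (by positivity), div_inv_eq_mul, ← Real.rpow_natCast,
        ← Real.rpow_mul (by positivity)]
      have h6 : ((8 * (n + 1) : ℕ) : ℝ) * (1 / (2 * ((4 * (n + 1) : ℕ) : ℝ))) = 1 := by
        push_cast; field_simp; norm_num
      rw [h6, Real.rpow_one, inv_inv, mul_comm]
      refine mul_le_mul_of_nonneg_right ?_ hrn.le
      refine (rpow_le_max_one (by positivity) (by positivity) (exp_le _ (by omega))).trans ?_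
      exact max_le (by nlinarith) le_rfl
    calc _ ≤ max 1 (m 0)⁻¹ * (max 1 (m 0) * (4 * C ^ 2 * r n)) :=
          mul_le_mul e1 (e2.trans (e3.trans (mul_le_mul_of_nonneg_left e4 (by positivity))))
            (Real.rpow_nonneg (div_pos (hpos _) h0).le _) (by positivity)
      _ = K * r n := by rw [hK]; ring
  have hdiv : Summable fun k : ℕ => r (k / 4) := by
    have h1 : Summable fun x : ℕ × Fin 4 => r x.1 * (1 : ℝ) :=
      hs.mul_of_nonneg (g := fun _ : Fin 4 => (1 : ℝ)) (Summable.of_finite)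
        (fun n => (rpos n).le) (fun _ => zero_le_one)
    have h2 := (Nat.divModEquiv 4).summable_iff.2 h1
    refine h2.congr fun k => ?_
    simp [Nat.divModEquiv]
  have hFs : Summable fun k => F (k + 4) :=
    Summable.of_norm_bounded_eventually_nat (hdiv.mul_left K) hbound
  have hF1 : Summable fun k => F (k + 1) :=
    (summable_nat_add_iff 1).2 ((summable_nat_add_iff 4).1 hFs)
  refine hF1.tsum_ofReal_ne_top ?_
  rw [← hS]
  refine tsum_congr fun n => ?_
  rw [hF, ← ENNReal.ofReal_rpow_of_pos (hpos _)]
  push_cast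
  rfl

/-- Integration over the unit interval, as a linear functional on polynomials. -/
noncomputable def unitIntegral : Polynomial ℝ →ₗ[ℝ] ℝ where
  toFun f := ∫ t in (0 : ℝ)..1, f.eval t
  map_add' f g := by
    simp only [Polynomial.eval_add]
    exact intervalIntegral.integral_add (f.continuous.intervalIntegrable _ _)
      (g.continuous.intervalIntegrable _ _)
  map_smul' c f := by
    simp only [Polynomial.eval_smul, smul_eq_mul, RingHom.id_apply]
    exact intervalIntegral.integral_const_mul _ _

theorem unitIntegral_pos {f : Polynomial ℝ} (hf : f ≠ 0) (hnn : ∀ t, 0 ≤ t → 0 ≤ f.eval t) :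
    0 < unitIntegral f := by
  refine intervalIntegral.integral_pos one_pos f.continuous.continuousOn
    (fun x hx => hnn x hx.1.le) ?_
  by_contra! h
  refine hf (Polynomial.eq_zero_of_infinite_isRoot f
    ((Set.Icc_infinite (zero_lt_one' ℝ)).mono fun x hx => ?_))
  exact le_antisymm (h x hx) (hnn x hx.1)

theorem unitIntegral_X_pow_le_one (k : ℕ) : unitIntegral (Polynomial.X ^ k) ≤ 1 := by
  change (∫ t in (0 : ℝ)..1, (Polynomial.X ^ k : Polynomial ℝ).eval t) ≤ 1
  simp only [Polynomial.eval_pow, Polynomial.eval_X, integral_pow]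
  simp only [one_pow, ne_eq, Nat.add_eq_zero_iff, one_ne_zero, and_false, not_false_eq_true,
    zero_pow, sub_zero]
  rw [div_le_one (by positivity)]
  linarith [(Nat.cast_nonneg k : (0 : ℝ) ≤ k)]

section Functional

variable {d : ℕ} {L : MvPolynomial (Fin d) ℝ →ₗ[ℝ] ℝ}

theorem moment_nonneg (hsq : ∀ p : MvPolynomial (Fin d) ℝ, 0 ≤ L (p ^ 2))
    (hxsq : ∀ (j : Fin d) (p : MvPolynomial (Fin d) ℝ), 0 ≤ L (X j * p ^ 2)) (j : Fin d) (k : ℕ) :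
    0 ≤ L (X j ^ k) := by
  obtain ⟨i, rfl | rfl⟩ := k.even_or_odd'
  · rw [mul_comm, pow_mul]; exact hsq _
  · rw [pow_succ', mul_comm 2 i, pow_mul]; exact hxsq _ _

theorem moment_logConvex (hsq : ∀ p : MvPolynomial (Fin d) ℝ, 0 ≤ L (p ^ 2))
    (hxsq : ∀ (j : Fin d) (p : MvPolynomial (Fin d) ℝ), 0 ≤ L (X j * p ^ 2)) (j : Fin d) (k : ℕ) :
    L (X j ^ (k + 1)) ^ 2 ≤ L (X j ^ k) * L (X j ^ (k + 2)) := by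
  obtain ⟨i, rfl | rfl⟩ := k.even_or_odd'
  · convert cauchy_schwarz_of_sq_nonneg L hsq (X j ^ i) (X j ^ (i + 1)) using 3 <;> ring_nf
  · have h := cauchy_schwarz_of_sq_nonneg (L ∘ₗ LinearMap.mulLeft ℝ (X j)) (hxsq j)
      (X j ^ i) (X j ^ (i + 1))
    change L (X j * (X j ^ i * X j ^ (i + 1))) ^ 2 ≤
      L (X j * (X j ^ i) ^ 2) * L (X j * (X j ^ (i + 1)) ^ 2) at h
    convert h using 3 <;> ring_nf

/-- The key approximation result: with respect to the weights `a ^ 2 + b ^ 2`, there are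
arbitrarily small polynomials in one of the variables which are at least one on a negative
half-line. -/
theorem exists_small_aeval (hsq : ∀ p : MvPolynomial (Fin d) ℝ, 0 ≤ L (p ^ 2))
    (hxsq : ∀ (j : Fin d) (p : MvPolynomial (Fin d) ℝ), 0 ≤ L (X j * p ^ 2))
    (j : Fin d)
    (hS : ∑' n : ℕ,
      (ENNReal.ofReal (L (X j ^ (n + 1)))) ^ (-(1 / (2 * ((n : ℝ) + 1)))) = ⊤)
    (a b : MvPolynomial (Fin d) ℝ) {δ ε : ℝ} (hδ : 0 < δ) (hε : 0 < ε) :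
    ∃ g : Polynomial ℝ, g.eval (-δ) = 1 ∧ (∀ t ≤ -δ, 1 ≤ g.eval t) ∧
      L ((a ^ 2 + b ^ 2) * (Polynomial.aeval (X j) g) ^ 2) ≤ ε := by
  set w := a ^ 2 + b ^ 2 with hw
  set M₀ : Polynomial ℝ →ₗ[ℝ] ℝ :=
    L ∘ₗ LinearMap.mulLeft ℝ w ∘ₗ (Polynomial.aeval (X j)).toLinearMap with hM₀
  have hM₀app : ∀ f, M₀ f = L (w * Polynomial.aeval (X j) f) := fun f => rfl
  have h1 : ∀ p, 0 ≤ M₀ (p ^ 2) := fun p => by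
    rw [hM₀app, map_pow, hw, add_mul, ← mul_pow, ← mul_pow, map_add]
    exact add_nonneg (hsq _) (hsq _)
  have h2 : ∀ p, 0 ≤ M₀ (Polynomial.X * p ^ 2) := fun p => by
    rw [hM₀app, map_mul (Polynomial.aeval (X j)), map_pow, hw, Polynomial.aeval_X,
      mul_left_comm, add_mul, ← mul_pow, ← mul_pow, mul_add, map_add]
    exact add_nonneg (hxsq _ _) (hxsq _ _)
  set M := M₀ + unitIntegral with hM
  have hMpos : ∀ p, p ≠ 0 → 0 < M (p ^ 2) := fun p hp =>
    add_pos_of_nonneg_of_pos (h1 p) (unitIntegral_pos (pow_ne_zero _ hp) fun t _ => by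
      rw [Polynomial.eval_pow]; positivity)
  have hXpos : ∀ p, p ≠ 0 → 0 < M (Polynomial.X * p ^ 2) := fun p hp =>
    add_pos_of_nonneg_of_pos (h2 p)
      (unitIntegral_pos (mul_ne_zero Polynomial.X_ne_zero (pow_ne_zero _ hp)) fun t ht => by
        rw [Polynomial.eval_mul, Polynomial.eval_pow, Polynomial.eval_X]; positivity)
  have hC := not_summable_of_stieltjes (m' := fun k => M (Polynomial.X ^ k))
    (moment_nonneg hsq hxsq j) (moment_logConvex hsq hxsq j) hS (fun k => ?_)
    (C := max 1 √(L (w ^ 2))) (le_max_left _ _) (fun k => ?_)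
  · obtain ⟨g, hg1, hg2, hg3⟩ := exists_small_of_not_summable hMpos hXpos hC hδ hε
    refine ⟨g, hg1, hg2, le_trans ?_ hg3⟩
    have : L (w * Polynomial.aeval (X j) g ^ 2) = M₀ (g ^ 2) := by rw [hM₀app, map_pow]
    rw [this, hM, LinearMap.add_apply, le_add_iff_nonneg_right]
    rcases eq_or_ne g 0 with rfl | hg
    · simp
    · exact (unitIntegral_pos (pow_ne_zero _ hg) fun t _ => by
        rw [Polynomial.eval_pow]; positivity).le
  · obtain ⟨i, rfl | rfl⟩ := k.even_or_odd'
    · have := hMpos (Polynomial.X ^ i) (pow_ne_zero _ Polynomial.X_ne_zero)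
      rwa [← pow_mul, mul_comm] at this
    · have := hXpos (Polynomial.X ^ i) (pow_ne_zero _ Polynomial.X_ne_zero)
      rwa [← pow_mul, mul_comm i, ← pow_succ'] at this
  · have e1 : M₀ (Polynomial.X ^ k) ≤ √(L (w ^ 2)) * √(L (X j ^ (2 * k))) := by
      rw [hM₀app, map_pow, Polynomial.aeval_X, ← Real.sqrt_mul (hsq w)]
      refine Real.le_sqrt_of_sq_le ?_
      have := cauchy_schwarz_of_sq_nonneg L hsq w (X j ^ k)
      rwa [← pow_mul, mul_comm k] at this
    have e2 := unitIntegral_X_pow_le_one k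
    have e3 : √(L (w ^ 2)) * √(L (X j ^ (2 * k))) ≤
        max 1 √(L (w ^ 2)) * √(L (X j ^ (2 * k))) :=
      mul_le_mul_of_nonneg_right (le_max_right _ _) (Real.sqrt_nonneg _)
    have e4 : (1 : ℝ) ≤ max 1 √(L (w ^ 2)) := le_max_left _ _
    change M₀ (Polynomial.X ^ k) + unitIntegral (Polynomial.X ^ k) ≤ _
    rw [mul_add, mul_one]
    linarith

end Functional

section Uniqueness

variable {d : ℕ} {L : MvPolynomial (Fin d) ℝ →ₗ[ℝ] ℝ}

theorem eval_aeval_X (x : Fin d → ℝ) (j : Fin d) (g : Polynomial ℝ) :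
    eval x (Polynomial.aeval (X j) g) = g.eval (x j) := by
  have h := Polynomial.aeval_algHom_apply (MvPolynomial.aeval (R := ℝ) x) (X j) g
  rw [aeval_X] at h
  simpa [MvPolynomial.coe_aeval_eq_eval, Polynomial.coe_aeval_eq_eval] using h.symm

theorem isFiniteMeasure_of_integrable_eval {μ : Measure (Fin d → ℝ)}
    (hint : ∀ p : MvPolynomial (Fin d) ℝ, Integrable (fun x => eval x p) μ) :
    IsFiniteMeasure μ := by
  have h := hint 1
  simp only [map_one] at h
  rcases (integrable_const_iff).1 h with h | h
  · norm_num at h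
  · exact h

/-- Under Stieltjes' condition every representing measure is concentrated on the orthant. -/
theorem ae_nonneg_of_represents (hsq : ∀ p : MvPolynomial (Fin d) ℝ, 0 ≤ L (p ^ 2))
    (hxsq : ∀ (j : Fin d) (p : MvPolynomial (Fin d) ℝ), 0 ≤ L (X j * p ^ 2)) (j : Fin d)
    (hS : ∑' n : ℕ, (ENNReal.ofReal (L (X j ^ (n + 1)))) ^ (-(1 / (2 * ((n : ℝ) + 1)))) = ⊤)
    {μ : Measure (Fin d → ℝ)}
    (hint : ∀ p : MvPolynomial (Fin d) ℝ, Integrable (fun x => eval x p) μ)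
    (hrep : ∀ p : MvPolynomial (Fin d) ℝ, L p = ∫ x, eval x p ∂μ) :
    ∀ᵐ x ∂μ, 0 ≤ x j := by
  have := isFiniteMeasure_of_integrable_eval hint
  have key : ∀ n : ℕ, ∀ᵐ x ∂μ, -(1 / ((n : ℝ) + 1)) < x j := by
    intro n
    have hδ : (0 : ℝ) < 1 / ((n : ℝ) + 1) := by positivity
    have hzero : μ.real {x | x j ≤ -(1 / ((n : ℝ) + 1))} ≤ 0 := by
      refine le_of_forall_pos_le_add fun ε hε => ?_
      obtain ⟨g, -, hg, hL⟩ := exists_small_aeval hsq hxsq j hS 1 0 hδ hε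
      have hLe : L ((Polynomial.aeval (X j) g) ^ 2) ≤ ε := by simpa using hL
      have hM := mul_meas_ge_le_integral_of_nonneg (μ := μ)
        (f := fun x => eval x ((Polynomial.aeval (X j) g) ^ 2))
        (Filter.Eventually.of_forall fun x => by simpa using sq_nonneg _)
        (hint _) 1
      rw [← hrep, one_mul] at hM
      rw [zero_add]
      refine (measureReal_mono ?_).trans (hM.trans hLe)
      intro x hx
      have := hg _ hx
      simp only [Set.mem_ofPred_eq, map_pow, eval_aeval_X]
      nlinarith
    have h0 : μ {x | x j ≤ -(1 / ((n : ℝ) + 1))} = 0 := by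
      rw [← measureReal_eq_zero_iff]
      exact le_antisymm hzero measureReal_nonneg
    rw [ae_iff]
    simpa only [not_lt] using h0
  filter_upwards [ae_all_iff.2 key] with x hx
  by_contra! hneg
  obtain ⟨n, hn⟩ := exists_nat_one_div_lt (neg_pos.2 hneg)
  linarith [hx n]

/-- Square-integrable approximability by polynomials. -/
def PolyApproximable (ν : Measure (Fin d → ℝ)) (u : (Fin d → ℝ) → ℝ) : Prop :=
  AEStronglyMeasurable u ν ∧ ∀ ε : ℝ, 0 < ε → ∃ p : MvPolynomial (Fin d) ℝ,
    eLpNorm (fun x => u x - eval x p) 2 ν ≤ ENNReal.ofReal ε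

theorem continuous_eval_left (p : MvPolynomial (Fin d) ℝ) : Continuous fun x => eval x p :=
  MvPolynomial.continuous_eval p

theorem PolyApproximable.add {ν : Measure (Fin d → ℝ)} {u v : (Fin d → ℝ) → ℝ}
    (hu : PolyApproximable ν u) (hv : PolyApproximable ν v) :
    PolyApproximable ν (fun x => u x + v x) := by
  refine ⟨hu.1.add hv.1, fun ε hε => ?_⟩
  obtain ⟨p, hp⟩ := hu.2 (ε / 2) (half_pos hε)
  obtain ⟨q, hq⟩ := hv.2 (ε / 2) (half_pos hε)
  refine ⟨p + q, ?_⟩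
  have h := eLpNorm_add_le (μ := ν) (p := 2)
    (hu.1.sub (continuous_eval_left p).aestronglyMeasurable)
    (hv.1.sub (continuous_eval_left q).aestronglyMeasurable) (by norm_num)
  calc eLpNorm (fun x => u x + v x - eval x (p + q)) 2 ν
      = eLpNorm ((fun x => u x - eval x p) + fun x => v x - eval x q) 2 ν := by
        congr 1; ext x; simp; ring
    _ ≤ _ := h
    _ ≤ ENNReal.ofReal (ε / 2) + ENNReal.ofReal (ε / 2) := add_le_add hp hq
    _ = ENNReal.ofReal ε := by
        rw [← ENNReal.ofReal_add (by positivity) (by positivity), add_halves]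

theorem PolyApproximable.const_mul {ν : Measure (Fin d → ℝ)} {u : (Fin d → ℝ) → ℝ}
    (hu : PolyApproximable ν u) (r : ℝ) : PolyApproximable ν (fun x => r * u x) := by
  refine ⟨hu.1.const_mul r, fun ε hε => ?_⟩
  obtain ⟨p, hp⟩ := hu.2 (ε / (|r| + 1)) (by positivity)
  refine ⟨C r * p, ?_⟩
  calc eLpNorm (fun x => r * u x - eval x (C r * p)) 2 ν
      = eLpNorm (r • fun x => u x - eval x p) 2 ν := by
        congr 1; ext x; simp; ring
    _ = ENNReal.ofReal |r| * eLpNorm (fun x => u x - eval x p) 2 ν := by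
        rw [eLpNorm_const_smul, Real.enorm_eq_ofReal_abs]
    _ ≤ ENNReal.ofReal |r| * ENNReal.ofReal (ε / (|r| + 1)) := by gcongr
    _ ≤ ENNReal.ofReal ε := by
        rw [← ENNReal.ofReal_mul (abs_nonneg r)]
        apply ENNReal.ofReal_le_ofReal
        rw [mul_div_assoc', div_le_iff₀ (by positivity)]
        nlinarith [abs_nonneg r]

theorem polyApproximable_eval (ν : Measure (Fin d → ℝ)) (p : MvPolynomial (Fin d) ℝ) :
    PolyApproximable ν (fun x => eval x p) :=
  ⟨(continuous_eval_left p).aestronglyMeasurable, fun ε _ => ⟨p, by simp⟩⟩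

/-- A limit of polynomially approximable functions is polynomially approximable. -/
theorem polyApproximable_of_forall {ν : Measure (Fin d → ℝ)} {u : (Fin d → ℝ) → ℝ}
    (hm : AEStronglyMeasurable u ν)
    (h : ∀ ε : ℝ, 0 < ε → ∃ v, PolyApproximable ν v ∧
      eLpNorm (fun x => u x - v x) 2 ν ≤ ENNReal.ofReal ε) : PolyApproximable ν u := by
  refine ⟨hm, fun ε hε => ?_⟩
  obtain ⟨v, hv, huv⟩ := h (ε / 2) (half_pos hε)
  obtain ⟨p, hp⟩ := hv.2 (ε / 2) (half_pos hε)
  refine ⟨p, ?_⟩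
  calc eLpNorm (fun x => u x - eval x p) 2 ν
      = eLpNorm ((fun x => u x - v x) + fun x => v x - eval x p) 2 ν := by
        congr 1; ext x; simp
    _ ≤ _ := eLpNorm_add_le (hm.sub hv.1)
        (hv.1.sub (continuous_eval_left p).aestronglyMeasurable) (by norm_num)
    _ ≤ ENNReal.ofReal (ε / 2) + ENNReal.ofReal (ε / 2) := add_le_add huv hp
    _ = ENNReal.ofReal ε := by
        rw [← ENNReal.ofReal_add (by positivity) (by positivity), add_halves]

/-- A bounded injective function on the line which equals `1 / (1 + t)` on the half-line. -/
noncomputable def resolventFun (t : ℝ) : ℝ := 1 - t / (1 + |t|)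

theorem continuous_resolventFun : Continuous resolventFun := by
  unfold resolventFun
  refine continuous_const.sub (continuous_id.div (by fun_prop) fun t => ?_)
  positivity

theorem abs_resolventFun_le (t : ℝ) : |resolventFun t| ≤ 2 := by
  unfold resolventFun
  have h : |t / (1 + |t|)| ≤ 1 := by
    rw [abs_div, abs_of_pos (by positivity : 0 < 1 + |t|), div_le_one (by positivity)]
    linarith
  rw [abs_le] at h ⊢
  constructor <;> linarith [h.1, h.2]

theorem resolventFun_of_nonneg {t : ℝ} (ht : 0 ≤ t) : resolventFun t = 1 / (1 + t) := by
  unfold resolventFun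
  rw [abs_of_nonneg ht]
  field_simp
  ring

theorem resolventFun_injective : Function.Injective resolventFun := by
  intro s t h
  unfold resolventFun at h
  have h' : s / (1 + |s|) = t / (1 + |t|) := by linarith
  rw [div_eq_div_iff (by positivity) (by positivity)] at h'
  rcases abs_cases s with ⟨hs, _⟩ | ⟨hs, _⟩ <;> rcases abs_cases t with ⟨ht, _⟩ | ⟨ht, _⟩ <;>
    rw [hs, ht] at h' <;> nlinarith

theorem eLpNorm_eval_le {ν : Measure (Fin d → ℝ)} {q : MvPolynomial (Fin d) ℝ} {ε : ℝ}
    (hint : ∀ p : MvPolynomial (Fin d) ℝ, Integrable (fun x => eval x p) ν) (hε : 0 ≤ ε)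
    (h : ∫ x, eval x (q ^ 2) ∂ν ≤ ε ^ 2) :
    eLpNorm (fun x => eval x q) 2 ν ≤ ENNReal.ofReal ε := by
  have hmem : MemLp (fun x => eval x q) 2 ν := by
    rw [memLp_two_iff_integrable_sq (continuous_eval_left q).aestronglyMeasurable]
    exact (hint (q ^ 2)).congr (ae_of_all _ fun x => map_pow (eval x) q 2)
  rw [hmem.eLpNorm_eq_integral_rpow_norm (by norm_num) (by norm_num)]
  apply ENNReal.ofReal_le_ofReal
  simp only [ENNReal.toReal_ofNat, Real.rpow_ofNat, Real.norm_eq_abs, sq_abs]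
  simp only [map_pow] at h
  calc (∫ x, eval x q ^ 2 ∂ν) ^ (2 : ℝ)⁻¹ ≤ (ε ^ 2) ^ (2 : ℝ)⁻¹ :=
        Real.rpow_le_rpow (integral_nonneg fun x => sq_nonneg _) h (by norm_num)
    _ = ε := by
        rw [← one_div, ← Real.sqrt_eq_rpow, Real.sqrt_sq hε]

/-- Multiplication by `1 / (1 + x_j)` preserves polynomial approximability. -/
theorem PolyApproximable.resolventFun_mul {ν : Measure (Fin d → ℝ)} {j : Fin d}
    (hint : ∀ p : MvPolynomial (Fin d) ℝ, Integrable (fun x => eval x p) ν)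
    (hpos : ∀ᵐ x ∂ν, 0 ≤ x j)
    (hsmall : ∀ (a : MvPolynomial (Fin d) ℝ) (ε : ℝ), 0 < ε → ∃ g : Polynomial ℝ,
      g.eval (-1) = 1 ∧ ∫ x, eval x ((a * Polynomial.aeval (X j) g) ^ 2) ∂ν ≤ ε)
    {u : (Fin d → ℝ) → ℝ} (hu : PolyApproximable ν u) :
    PolyApproximable ν (fun x => resolventFun (x j) * u x) := by
  have hcont : Continuous fun x : Fin d → ℝ => resolventFun (x j) :=
    continuous_resolventFun.comp (continuous_apply j)
  have hle : ∀ᵐ x ∂ν, ∀ v : ℝ, ‖resolventFun (x j) * v‖ ≤ ‖v‖ := by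
    filter_upwards [hpos] with x hx v
    rw [norm_mul, resolventFun_of_nonneg hx, Real.norm_of_nonneg (by positivity)]
    refine mul_le_of_le_one_left (norm_nonneg _) ?_
    rw [div_le_one (by positivity)]
    linarith
  have hpoly : ∀ p : MvPolynomial (Fin d) ℝ,
      PolyApproximable ν (fun x => resolventFun (x j) * eval x p) := by
    intro p
    refine ⟨hcont.aestronglyMeasurable.mul (continuous_eval_left p).aestronglyMeasurable,
      fun ε hε => ?_⟩
    obtain ⟨g, hg, hgε⟩ := hsmall p (ε ^ 2) (by positivity)
    obtain ⟨f, hf⟩ : Polynomial.X - Polynomial.C (-1 : ℝ) ∣ 1 - g :=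
      Polynomial.dvd_iff_isRoot.2 (by simp [hg])
    refine ⟨Polynomial.aeval (X j) f * p, le_trans ?_ (eLpNorm_eval_le hint hε.le hgε)⟩
    refine eLpNorm_mono_ae ?_
    filter_upwards [hpos, hle] with x hx hx'
    have hfx : 1 - g.eval (x j) = (x j + 1) * f.eval (x j) := by
      simpa using congrArg (Polynomial.eval (x j)) hf
    refine le_trans (le_of_eq ?_) (hx' _)
    congr 1
    simp only [map_mul, eval_aeval_X, resolventFun_of_nonneg hx]
    have : (1 + x j) ≠ 0 := by positivity
    field_simp
    linear_combination (eval x p) * hfx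
  refine polyApproximable_of_forall (hcont.aestronglyMeasurable.mul hu.1) fun ε hε => ?_
  obtain ⟨p, hp⟩ := hu.2 ε hε
  refine ⟨_, hpoly p, le_trans (eLpNorm_mono_ae ?_) hp⟩
  filter_upwards [hle] with x hx
  rw [← mul_sub]
  exact hx _

/-- The function `1 / (1 + x_j)`, extended to a bounded continuous function on the space. -/
noncomputable def resolventBCF (j : Fin d) : BoundedContinuousFunction (Fin d → ℝ) ℝ :=
  BoundedContinuousFunction.ofNormedAddCommGroup (fun x => resolventFun (x j))
    (continuous_resolventFun.comp (continuous_apply j)) 2 fun _ => abs_resolventFun_le _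

theorem PolyApproximable.mul_of_mem_adjoin {ν : Measure (Fin d → ℝ)}
    (hmul : ∀ (j : Fin d) u, PolyApproximable ν u →
      PolyApproximable ν (fun x => resolventFun (x j) * u x))
    {h : BoundedContinuousFunction (Fin d → ℝ) ℝ}
    (hh : h ∈ StarAlgebra.adjoin ℝ (Set.range (resolventBCF (d := d))))
    {u : (Fin d → ℝ) → ℝ} (hu : PolyApproximable ν u) :
    PolyApproximable ν (fun x => h x * u x) := by
  induction hh using StarAlgebra.adjoin_induction generalizing u with
  | mem _ hx =>
    obtain ⟨j, rfl⟩ := hx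
    exact hmul j u hu
  | algebraMap r => exact hu.const_mul r
  | add x y _ _ hx hy => simpa [add_mul] using (hx hu).add (hy hu)
  | mul x y _ _ hx hy => simpa [mul_assoc] using hx (hy hu)
  | star _ _ hx => simpa using hx hu

theorem PolyApproximable.integral_eq {μ₁ μ₂ : Measure (Fin d → ℝ)}
    [IsFiniteMeasure μ₁] [IsFiniteMeasure μ₂]
    (h₁ : ∀ p : MvPolynomial (Fin d) ℝ, Integrable (fun x => eval x p) μ₁)
    (h₂ : ∀ p : MvPolynomial (Fin d) ℝ, Integrable (fun x => eval x p) μ₂)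
    (heq : ∀ p : MvPolynomial (Fin d) ℝ, ∫ x, eval x p ∂μ₁ = ∫ x, eval x p ∂μ₂)
    (h : BoundedContinuousFunction (Fin d → ℝ) ℝ)
    (ha : PolyApproximable (μ₁ + μ₂) h) : ∫ x, h x ∂μ₁ = ∫ x, h x ∂μ₂ := by
  set ν := μ₁ + μ₂ with hν
  set M : ℝ := (ν Set.univ ^ (1 / (1 : ENNReal).toReal - 1 / (2 : ENNReal).toReal)).toReal with hM
  have hMfin : ν Set.univ ^ (1 / (1 : ENNReal).toReal - 1 / (2 : ENNReal).toReal) ≠ ⊤ :=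
    ENNReal.rpow_ne_top_of_nonneg (by norm_num) (measure_ne_top _ _)
  have hM0 : 0 ≤ M := ENNReal.toReal_nonneg
  have bound : ∀ (p : MvPolynomial (Fin d) ℝ) (ε : ℝ), 0 < ε →
      eLpNorm (fun x => h x - eval x p) 2 ν ≤ ENNReal.ofReal ε →
      ∀ μ : Measure (Fin d → ℝ), [IsFiniteMeasure μ] → μ ≤ ν →
      Integrable (fun x => eval x p) μ →
      |∫ x, h x ∂μ - ∫ x, eval x p ∂μ| ≤ ε * M := by
    intro p ε hε hp μ _ hμ hi
    have hid : Integrable (fun x => h x - eval x p) μ := (h.integrable μ).sub hi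
    rw [← integral_sub (h.integrable μ) hi, ← Real.norm_eq_abs]
    refine (norm_integral_le_integral_norm _).trans ?_
    rw [← ENNReal.ofReal_le_ofReal_iff (by positivity), ofReal_integral_norm_eq_lintegral_enorm hid,
      ← eLpNorm_one_eq_lintegral_enorm, ENNReal.ofReal_mul hε.le, hM, ENNReal.ofReal_toReal hMfin]
    refine (eLpNorm_mono_measure _ hμ).trans ?_
    refine (eLpNorm_le_eLpNorm_mul_rpow_measure_univ (q := 2) (by norm_num)
      (h.continuous.sub (continuous_eval_left p)).aestronglyMeasurable).trans ?_
    gcongr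
    exact hp
  refine eq_of_forall_dist_le fun ε hε => ?_
  rw [Real.dist_eq]
  obtain ⟨p, hp⟩ := ha.2 (ε / (2 * (M + 1))) (by positivity)
  have b₁ := bound p _ (by positivity) hp μ₁ (Measure.le_add_right le_rfl) (h₁ p)
  have b₂ := bound p _ (by positivity) hp μ₂ (Measure.le_add_left le_rfl) (h₂ p)
  rw [heq p] at b₁
  have hle : ε / (2 * (M + 1)) * M ≤ ε / 2 := by
    rw [div_mul_eq_mul_div, div_le_div_iff₀ (by positivity) (by norm_num)]
    nlinarith
  rw [abs_le] at *
  constructor <;> linarith [b₁.1, b₁.2, b₂.1, b₂.2]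

theorem eq_of_represents (hsq : ∀ p : MvPolynomial (Fin d) ℝ, 0 ≤ L (p ^ 2))
    (hxsq : ∀ (j : Fin d) (p : MvPolynomial (Fin d) ℝ), 0 ≤ L (X j * p ^ 2))
    (hS : ∀ j : Fin d,
      ∑' n : ℕ, (ENNReal.ofReal (L (X j ^ (n + 1)))) ^ (-(1 / (2 * ((n : ℝ) + 1)))) = ⊤)
    {μ₁ μ₂ : Measure (Fin d → ℝ)}
    (h₁ : ∀ p : MvPolynomial (Fin d) ℝ, Integrable (fun x => eval x p) μ₁)
    (hr₁ : ∀ p : MvPolynomial (Fin d) ℝ, L p = ∫ x, eval x p ∂μ₁)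
    (h₂ : ∀ p : MvPolynomial (Fin d) ℝ, Integrable (fun x => eval x p) μ₂)
    (hr₂ : ∀ p : MvPolynomial (Fin d) ℝ, L p = ∫ x, eval x p ∂μ₂) : μ₁ = μ₂ := by
  have := isFiniteMeasure_of_integrable_eval h₁
  have := isFiniteMeasure_of_integrable_eval h₂
  have hint : ∀ p : MvPolynomial (Fin d) ℝ, Integrable (fun x => eval x p) (μ₁ + μ₂) :=
    fun p => (h₁ p).add_measure (h₂ p)
  have hmul : ∀ (j : Fin d) u, PolyApproximable (μ₁ + μ₂) u →
      PolyApproximable (μ₁ + μ₂) (fun x => resolventFun (x j) * u x) := by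
    intro j u hu
    refine hu.resolventFun_mul hint ?_ ?_
    · rw [ae_add_measure_iff]
      exact ⟨ae_nonneg_of_represents hsq hxsq j (hS j) h₁ hr₁,
        ae_nonneg_of_represents hsq hxsq j (hS j) h₂ hr₂⟩
    · intro a ε hε
      obtain ⟨g, hg, -, hL⟩ := exists_small_aeval hsq hxsq j (hS j) a 0 one_pos (half_pos hε)
      refine ⟨g, hg, ?_⟩
      rw [integral_add_measure (h₁ _) (h₂ _), ← hr₁, ← hr₂, mul_pow]
      have : L (a ^ 2 * Polynomial.aeval (X j) g ^ 2) ≤ ε / 2 := by simpa using hL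
      linarith
  refine ext_of_forall_mem_subalgebra_integral_eq_of_polish (𝕜 := ℝ)
    (A := StarAlgebra.adjoin ℝ (Set.range (resolventBCF (d := d)))) ?_ ?_
  · intro x y hxy
    obtain ⟨j, hj⟩ := Function.ne_iff.1 hxy
    exact ⟨resolventBCF j, ⟨_, ⟨resolventBCF j,
      StarAlgebra.subset_adjoin ℝ _ ⟨j, rfl⟩, rfl⟩, rfl⟩, fun h => hj (resolventFun_injective h)⟩
  · intro h hh
    refine PolyApproximable.integral_eq h₁ h₂ (fun p => by rw [← hr₁, ← hr₂]) h ?_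
    simpa using PolyApproximable.mul_of_mem_adjoin hmul hh (polyApproximable_eval _ 1)

end Uniqueness

section ComplexPair

/-- The complexification of a real vector space `A`; the pair `(a, b)` stands for `a + i b`. -/
def ComplexPair (A : Type*) := A × A

namespace ComplexPair

section Module

@[ext] theorem ext {A : Type*} {p q : ComplexPair A} (h₁ : p.1 = q.1) (h₂ : p.2 = q.2) : p = q :=
  Prod.ext h₁ h₂

variable {A : Type*} [AddCommGroup A]

instance : AddCommGroup (ComplexPair A) := inferInstanceAs (AddCommGroup (A × A))

@[simp] theorem add_fst (p q : ComplexPair A) : (p + q).1 = p.1 + q.1 := rfl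
@[simp] theorem add_snd (p q : ComplexPair A) : (p + q).2 = p.2 + q.2 := rfl
@[simp] theorem sub_fst (p q : ComplexPair A) : (p - q).1 = p.1 - q.1 := rfl
@[simp] theorem sub_snd (p q : ComplexPair A) : (p - q).2 = p.2 - q.2 := rfl
@[simp] theorem zero_fst : (0 : ComplexPair A).1 = 0 := rfl
@[simp] theorem zero_snd : (0 : ComplexPair A).2 = 0 := rfl

variable [Module ℝ A]

instance : SMul ℂ (ComplexPair A) :=
  ⟨fun z p => (z.re • p.1 - z.im • p.2, z.re • p.2 + z.im • p.1)⟩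

@[simp] theorem smul_fst (z : ℂ) (p : ComplexPair A) : (z • p).1 = z.re • p.1 - z.im • p.2 := rfl
@[simp] theorem smul_snd (z : ℂ) (p : ComplexPair A) : (z • p).2 = z.re • p.2 + z.im • p.1 := rfl

instance : Module ℂ (ComplexPair A) where
  one_smul p := by ext <;> simp
  mul_smul z w p := by
    ext <;> simp only [smul_fst, smul_snd, Complex.mul_re, Complex.mul_im] <;> module
  smul_zero z := by ext <;> simp
  smul_add z p q := by ext <;> simp only [smul_fst, smul_snd, add_fst, add_snd] <;> module
  add_smul z w p := by
    ext <;> simp only [smul_fst, smul_snd, add_fst, add_snd, Complex.add_re, Complex.add_im] <;>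
      module
  zero_smul p := by ext <;> simp

end Module

variable {A : Type*} [CommRing A] [Algebra ℝ A]

/-- Multiplication by an element of the real algebra. -/
def mulLeft (r : A) : ComplexPair A →ₗ[ℂ] ComplexPair A where
  toFun p := (r * p.1, r * p.2)
  map_add' p q := by
    ext
    · exact mul_add r p.1 q.1
    · exact mul_add r p.2 q.2
  map_smul' z p := by
    ext
    · change r * (z.re • p.1 - z.im • p.2) = z.re • (r * p.1) - z.im • (r * p.2)
      rw [mul_sub, mul_smul_comm, mul_smul_comm]
    · change r * (z.re • p.2 + z.im • p.1) = z.re • (r * p.2) + z.im • (r * p.1)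
      rw [mul_add, mul_smul_comm, mul_smul_comm]

@[simp] theorem mulLeft_fst (r : A) (p : ComplexPair A) : (mulLeft r p).1 = r * p.1 := rfl
@[simp] theorem mulLeft_snd (r : A) (p : ComplexPair A) : (mulLeft r p).2 = r * p.2 := rfl

theorem mulLeft_one (p : ComplexPair A) : mulLeft 1 p = p := by ext <;> simp

theorem mulLeft_mul (r s : A) (p : ComplexPair A) :
    mulLeft (r * s) p = mulLeft r (mulLeft s p) := by
  ext <;> simp [mul_assoc]

/-- The sesquilinear form `⟨p, q⟩ = L (conj p * q)`. -/
def innerForm (L : A →ₗ[ℝ] ℝ) (p q : ComplexPair A) : ℂ :=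
  ⟨L (p.1 * q.1 + p.2 * q.2), L (p.1 * q.2 - p.2 * q.1)⟩

/-- The semi-inner product on the complexification given by a functional which is nonnegative on
squares. -/
@[reducible] def preInnerCore (L : A →ₗ[ℝ] ℝ) (hL : ∀ a, 0 ≤ L (a ^ 2)) :
    PreInnerProductSpace.Core ℂ (ComplexPair A) where
  inner := innerForm L
  conj_inner_symm p q := by
    apply Complex.ext
    · simp [innerForm, mul_comm]
    · simp [innerForm, mul_comm]
  re_inner_nonneg p := by
    have : 0 ≤ L (p.1 * p.1 + p.2 * p.2) := by
      rw [map_add, ← sq, ← sq]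
      exact add_nonneg (hL _) (hL _)
    simpa [innerForm] using this
  add_left p q r := by
    apply Complex.ext
    · simp [innerForm, add_mul]; ring
    · simp [innerForm, add_mul]; ring
  smul_left p q z := by
    apply Complex.ext
    · simp [innerForm, add_mul, sub_mul]; ring
    · simp [innerForm, add_mul, sub_mul]; ring

end ComplexPair

attribute [local instance] InnerProductSpace.Core.toSeminormedAddCommGroup in
/-- The Hilbert space obtained from a semi-inner product by separation and completion. -/
theorem exists_hilbert_of_preInner {V : Type} [AddCommGroup V] [Module ℂ V]
    (c : PreInnerProductSpace.Core ℂ V) :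
    ∃ (H : Type) (_ : NormedAddCommGroup H) (_ : InnerProductSpace ℂ H) (_ : CompleteSpace H)
      (ι : V →ₗ[ℂ] H), DenseRange ι ∧ ∀ x y, inner ℂ (ι x) (ι y) = c.inner x y := by
  let _ : InnerProductSpace ℂ V := InnerProductSpace.ofCore c
  exact ⟨UniformSpace.Completion V, inferInstance, inferInstance, inferInstance,
    (UniformSpace.Completion.toComplL (𝕜 := ℂ) (E := V) : V →L[ℂ] _).toLinearMap,
    UniformSpace.Completion.denseRange_coe, fun x y => UniformSpace.Completion.inner_coe x y⟩

end ComplexPair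

section Resolvent

open ComplexPair

variable {A : Type} [CommRing A] [Algebra ℝ A] {L : A →ₗ[ℝ] ℝ}
  {H : Type} [NormedAddCommGroup H] [InnerProductSpace ℂ H] {ι : ComplexPair A →ₗ[ℂ] H}

theorem norm_sq_of_inner_eq (hι : ∀ p q, inner ℂ (ι p) (ι q) = innerForm L p q)
    (p : ComplexPair A) : ‖ι p‖ ^ 2 = L (p.1 ^ 2 + p.2 ^ 2) := by
  have h := inner_self_eq_norm_sq (𝕜 := ℂ) (ι p)
  rw [hι] at h
  rw [← h, sq, sq]
  rfl

/-- A real algebra element by which one can approximately divide in the `L²` seminorm. -/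
def HasDenseMul (L : A →ₗ[ℝ] ℝ) (s : A) : Prop :=
  ∀ (a b : A) (ε : ℝ), 0 < ε → ∃ f : A, L ((a - s * f * a) ^ 2 + (b - s * f * b) ^ 2) ≤ ε

theorem HasDenseMul.denseRange_mul (hι : ∀ p q, inner ℂ (ι p) (ι q) = innerForm L p q) {s r : A}
    (hs : HasDenseMul L s) (hr : DenseRange fun p => ι (mulLeft r p)) :
    DenseRange fun p => ι (mulLeft (r * s) p) := by
  intro v
  rw [Metric.mem_closure_range_iff]
  intro ε hε
  obtain ⟨_, ⟨q, rfl⟩, hq⟩ := Metric.mem_closure_iff.1 (hr v) (ε / 2) (half_pos hε)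
  obtain ⟨f, hf⟩ := hs (r * q.1) (r * q.2) ((ε / 4) ^ 2) (by positivity)
  refine ⟨mulLeft f q, ?_⟩
  have hn : ‖ι (mulLeft r q) - ι (mulLeft (r * s) (mulLeft f q))‖ ≤ ε / 4 := by
    rw [← map_sub]
    refine le_of_sq_le_sq ?_ (by positivity)
    rw [norm_sq_of_inner_eq hι]
    refine le_trans (le_of_eq ?_) hf
    congr 2 <;> simp <;> ring
  calc dist v _ ≤ dist v (ι (mulLeft r q)) + dist (ι (mulLeft r q)) _ := dist_triangle _ _ _
    _ < ε := by
        rw [dist_eq_norm (ι (mulLeft r q))]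
        linarith

theorem exists_resolvent [CompleteSpace H]
    (hι : ∀ p q, inner ℂ (ι p) (ι q) = innerForm L p q) (hdense : DenseRange ι) {s : A}
    (hs : HasDenseMul L s) (hle : ∀ a, L (a ^ 2) ≤ L ((s * a) ^ 2))
    (hpos : ∀ a, 0 ≤ L (s * a ^ 2)) :
    ∃ R : H →L[ℂ] H, R.IsPositive ∧ ‖R‖ ≤ 1 ∧ ∀ p, R (ι (mulLeft s p)) = ι p := by
  have hd : DenseRange (ι ∘ₗ mulLeft s) := by
    have h := hs.denseRange_mul (r := 1) hι (by simpa [mulLeft_one] using hdense)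
    rw [one_mul] at h
    exact h
  have hnorm : ∀ p, ‖ι p‖ ≤ 1 * ‖(ι ∘ₗ mulLeft s) p‖ := by
    intro p
    rw [one_mul]
    refine le_of_sq_le_sq ?_ (norm_nonneg _)
    rw [LinearMap.comp_apply, norm_sq_of_inner_eq hι, norm_sq_of_inner_eq hι, map_add, map_add]
    exact add_le_add (hle _) (hle _)
  let R : H →L[ℂ] H := LinearMap.extendOfNorm ι (ι ∘ₗ mulLeft s)
  have hR : ∀ p, R (ι (mulLeft s p)) = ι p := fun p =>
    LinearMap.extendOfNorm_eq hd ⟨1, hnorm⟩ p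
  have hsymm : ∀ v w, inner ℂ (R v) w = inner ℂ v (R w) := by
    intro v w
    refine hd.induction_on₂ (p := fun v w => inner ℂ (R v) w = inner ℂ v (R w)) ?_ ?_ v w
    · exact isClosed_eq (by fun_prop) (by fun_prop)
    · intro p q
      simp only [LinearMap.comp_apply, hR, hι]
      apply Complex.ext <;> simp only [innerForm, mulLeft_fst, mulLeft_snd] <;> congr 1 <;> ring
  refine ⟨R, ?_, ?_, hR⟩
  · refine ContinuousLinearMap.isPositive_def.2 ⟨hsymm, fun v => ?_⟩
    refine hd.induction_on (p := fun v => 0 ≤ R.reApplyInnerSelf v) v ?_ fun p => ?_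
    · exact isClosed_le continuous_const R.reApplyInnerSelf_continuous
    · have h := add_nonneg (hpos p.1) (hpos p.2)
      rw [← map_add] at h
      rw [ContinuousLinearMap.reApplyInnerSelf_apply, LinearMap.comp_apply, hR, hι]
      refine h.trans (le_of_eq ?_)
      change _ = L (p.1 * (s * p.1) + p.2 * (s * p.2))
      congr 1
      ring
  · refine R.opNorm_le_bound zero_le_one fun v => ?_
    exact LinearMap.norm_extendOfNorm_apply_le hd 1 hnorm v

theorem resolvent_comm (hι : ∀ p q, inner ℂ (ι p) (ι q) = innerForm L p q) (hdense : DenseRange ι)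
    {s t : A} (hs : HasDenseMul L s) (ht : HasDenseMul L t) {R S : H →L[ℂ] H}
    (hR : ∀ p, R (ι (mulLeft s p)) = ι p) (hS : ∀ p, S (ι (mulLeft t p)) = ι p) :
    R * S = S * R := by
  have hd : DenseRange fun p => ι (mulLeft (1 * s * t) p) :=
    ht.denseRange_mul hι (hs.denseRange_mul hι (by simpa [mulLeft_one] using hdense))
  refine ContinuousLinearMap.coeFn_injective (hd.equalizer (by fun_prop) (by fun_prop) ?_)
  funext p
  change R (S (ι (mulLeft (1 * s * t) p))) = S (R (ι (mulLeft (1 * s * t) p)))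
  rw [one_mul, mulLeft_mul, hR, hS, ← mulLeft_mul, mul_comm, mulLeft_mul, hS, hR]

end Resolvent

section FunctionalCalculus

variable {κ : Type*}

/-- A coordinate of the unit cube as a continuous function. -/
def cubeCoord (j : κ) : C(κ → unitInterval, ℝ) := ⟨fun y => (y j : ℝ), by fun_prop⟩

open WeakDual in
theorem exists_cube_functionalCalculus_of_comm {A : Type*} [CommCStarAlgebra A] (a : κ → A)
    (ha : ∀ j, spectrum ℂ (a j) ⊆ (fun t : ℝ => (t : ℂ)) '' Set.Icc 0 1) :
    ∃ Φ : C(κ → unitInterval, ℝ) →ₐ[ℝ] A,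
      (∀ g, IsSelfAdjoint (Φ g)) ∧ ∀ j, Φ (cubeCoord j) = a j := by
  have hχ : ∀ (χ : characterSpace ℂ A) (j : κ),
      ∃ t : unitInterval, ((t : ℝ) : ℂ) = χ (a j) := by
    intro χ j
    obtain ⟨t, ht, h⟩ := ha j (AlgHom.apply_mem_spectrum χ (a j))
    exact ⟨⟨t, ht⟩, h⟩
  choose y hy using hχ
  have hyc : Continuous y := by
    refine continuous_pi fun j => ?_
    rw [continuous_induced_rng]
    have : (Subtype.val ∘ fun χ => y χ j) = fun χ => (χ (a j)).re := by
      ext χ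
      simp [← hy]
    rw [this]
    exact Complex.continuous_re.comp (gelfandTransform ℂ A (a j)).continuous
  let Γ := (gelfandStarTransform A).symm
  let Ψ : C(κ → unitInterval, ℝ) →ₐ[ℝ] C(characterSpace ℂ A, ℂ) :=
    (Complex.ofRealAm.compLeftContinuous ℝ Complex.continuous_ofReal).comp
      (ContinuousMap.compRightAlgHom ℝ ℝ ⟨y, hyc⟩)
  let Γ' : C(characterSpace ℂ A, ℂ) →⋆ₐ[ℂ] A := Γ
  refine ⟨(Γ'.toAlgHom.restrictScalars ℝ).comp Ψ, ?_, ?_⟩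
  · intro g
    have h : IsSelfAdjoint (Ψ g) := by
      ext χ
      exact Complex.conj_ofReal _
    exact h.map Γ
  · intro j
    have : Ψ (cubeCoord j) = gelfandStarTransform A (a j) := by
      ext χ
      exact hy χ j
    change Γ (Ψ (cubeCoord j)) = a j
    rw [this]
    exact (gelfandStarTransform A).symm_apply_apply _

open StarAlgebra StarSubalgebra in
open scoped IsMulCommutative in
theorem exists_cube_functionalCalculus {A : Type*} [CStarAlgebra A] (a : κ → A)
    (hsa : ∀ j, IsSelfAdjoint (a j)) (hcomm : ∀ i j, a i * a j = a j * a i)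
    (ha : ∀ j, spectrum ℂ (a j) ⊆ (fun t : ℝ => (t : ℂ)) '' Set.Icc 0 1) :
    ∃ Φ : C(κ → unitInterval, ℝ) →ₐ[ℝ] A,
      (∀ g, IsSelfAdjoint (Φ g)) ∧ ∀ j, Φ (cubeCoord j) = a j := by
  let S : StarSubalgebra ℂ A := (adjoin ℂ (Set.range a)).topologicalClosure
  have hS : IsClosed (S : Set A) := (adjoin ℂ (Set.range a)).isClosed_topologicalClosure
  have : IsMulCommutative (adjoin ℂ (Set.range a)) := by
    refine isMulCommutative_adjoin ℂ ?_ ?_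
    · rintro _ ⟨i, rfl⟩ _ ⟨j, rfl⟩
      exact hcomm i j
    · rintro _ ⟨i, rfl⟩ _ ⟨j, rfl⟩
      rw [(hsa j).star_eq]
      exact hcomm i j
  let _ : CommRing S := (adjoin ℂ (Set.range a)).commRingTopologicalClosure mul_comm
  let _ : CommCStarAlgebra S := { }
  have hmem : ∀ j, a j ∈ S := fun j => le_topologicalClosure _ (subset_adjoin ℂ _ ⟨j, rfl⟩)
  obtain ⟨Φ, hΦ, hΦa⟩ := exists_cube_functionalCalculus_of_comm (A := S)
    (fun j => ⟨a j, hmem j⟩) (fun j => by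
      have h := StarSubalgebra.spectrum_eq S (a := ⟨a j, hmem j⟩)
      exact h.le.trans (ha j))
  refine ⟨(S.subtype.toAlgHom.restrictScalars ℝ).comp Φ, fun g => (hΦ g).map S.subtype,
    fun j => ?_⟩
  exact congrArg Subtype.val (hΦa j)

variable {H : Type*} [NormedAddCommGroup H] [InnerProductSpace ℂ H] [CompleteSpace H]

theorem ContinuousLinearMap.IsPositive.spectrum_subset_Icc {R : H →L[ℂ] H} (hR : R.IsPositive)
    (hle : ‖R‖ ≤ 1) : spectrum ℂ R ⊆ (fun t : ℝ => (t : ℂ)) '' Set.Icc 0 1 := by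
  intro z hz
  have hnn := hR.spectrumRestricts
  have hzr : z = (z.re : ℂ) := (hR.isSelfAdjoint.mem_spectrum_eq_re hz)
  refine ⟨z.re, ⟨?_, ?_⟩, hzr.symm⟩
  · rw [SpectrumRestricts.nnreal_iff] at hnn
    refine hnn _ ?_
    have : (algebraMap ℝ ℂ z.re) ∈ spectrum ℂ R := by
      rw [Complex.coe_algebraMap, ← hzr]; exact hz
    exact spectrum.algebraMap_mem_iff (R := ℝ) ℂ |>.1 this
  · have h1 : ‖z‖ ≤ ‖R‖ * ‖(1 : H →L[ℂ] H)‖ := spectrum.norm_le_norm_mul_of_mem hz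
    have h2 : ‖(1 : H →L[ℂ] H)‖ ≤ 1 := ContinuousLinearMap.norm_id_le
    exact (Complex.re_le_norm z).trans (h1.trans (by nlinarith [norm_nonneg R]))

/-- Joint continuous functional calculus of commuting positive contractions. -/
theorem exists_cube_functionalCalculus_of_isPositive (R : κ → H →L[ℂ] H)
    (hR : ∀ j, (R j).IsPositive) (hle : ∀ j, ‖R j‖ ≤ 1) (hcomm : ∀ i j, R i * R j = R j * R i) :
    ∃ Φ : C(κ → unitInterval, ℝ) →ₐ[ℝ] (H →L[ℂ] H),
      (∀ g, IsSelfAdjoint (Φ g)) ∧ ∀ j, Φ (cubeCoord j) = R j :=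
  exists_cube_functionalCalculus R (fun j => (hR j).isSelfAdjoint) hcomm
    fun j => (hR j).spectrum_subset_Icc (hle j)

end FunctionalCalculus

section SpectralMeasure

variable {X : Type*} [TopologicalSpace X] [CompactSpace X] [MeasurableSpace X]
  [BorelSpace X] {H : Type*} [NormedAddCommGroup H] [InnerProductSpace ℂ H] [CompleteSpace H]
  {Φ : C(X, ℝ) →ₐ[ℝ] (H →L[ℂ] H)}

omit [CompactSpace X] [MeasurableSpace X] [BorelSpace X] in
theorem inner_functionalCalculus_mul (hΦ : ∀ g, IsSelfAdjoint (Φ g)) (g h : C(X, ℝ)) (v w : H) :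
    inner ℂ (Φ g v) (Φ h w) = inner ℂ (Φ (g * h) v) w := by
  rw [mul_comm, map_mul]
  exact ((ContinuousLinearMap.isSelfAdjoint_iff_isSymmetric.1 (hΦ h)) (Φ g v) w).symm

/-- The scalar spectral measure of a vector for a continuous functional calculus. -/
theorem exists_spectralMeasure [T2Space X] (hΦ : ∀ g, IsSelfAdjoint (Φ g)) (v : H) :
    ∃ ν : Measure X, IsFiniteMeasure ν ∧
      ∀ g : C(X, ℝ), ∫ x, g x ∂ν = (inner ℂ (Φ g v) v).re := by
  let F : CompactlySupportedContinuousMap X ℝ →ₗ[ℝ] ℝ :=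
    { toFun := fun g => (inner ℂ (Φ g.toContinuousMap v) v).re
      map_add' := fun g h => by
        have : (g + h).toContinuousMap = g.toContinuousMap + h.toContinuousMap := rfl
        rw [this, map_add, add_apply, inner_add_left, Complex.add_re]
      map_smul' := fun r g => by
        have : (r • g).toContinuousMap = r • g.toContinuousMap := rfl
        rw [this, map_smul]
        simp [inner_smul_left_eq_smul] }
  have hF : ∀ g, 0 ≤ g → 0 ≤ F g := by
    intro g hg
    let r : C(X, ℝ) := ⟨fun x => Real.sqrt (g x), by fun_prop⟩
    have hr : g.toContinuousMap = r * r := by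
      ext x
      exact (Real.mul_self_sqrt (hg x)).symm
    change 0 ≤ (inner ℂ (Φ g.toContinuousMap v) v).re
    rw [hr, ← inner_functionalCalculus_mul hΦ]
    exact inner_self_nonneg (𝕜 := ℂ)
  let Λ := PositiveLinearMap.mk₀ F hF
  refine ⟨RealRMK.rieszMeasure Λ, inferInstance, fun g => ?_⟩
  exact RealRMK.integral_rieszMeasure Λ ⟨g, HasCompactSupport.of_compactSpace g⟩

variable {ν ρ : Measure X} [IsFiniteMeasure ν] [IsFiniteMeasure ρ]

/-- Applying `q` to a vector multiplies its spectral measure by the density `q ^ 2`. -/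
theorem spectralMeasure_eq_withDensity [HasOuterApproxClosed X] (hΦ : ∀ g, IsSelfAdjoint (Φ g))
    {u v : H} (hν : ∀ g : C(X, ℝ), ∫ x, g x ∂ν = (inner ℂ (Φ g v) v).re)
    (hρ : ∀ g : C(X, ℝ), ∫ x, g x ∂ρ = (inner ℂ (Φ g u) u).re) {q : C(X, ℝ)} (hq : Φ q u = v) :
    ν = ρ.withDensity fun x => ((q x ^ 2).toNNReal : ENNReal) := by
  have hm : Measurable fun x => (q x ^ 2).toNNReal := by
    have := q.continuous.measurable
    fun_prop
  have hint : Integrable (fun x => q x ^ 2) ρ :=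
    (q ^ 2).continuous.integrable_of_hasCompactSupport (HasCompactSupport.of_compactSpace _)
  have : IsFiniteMeasure (ρ.withDensity fun x => ((q x ^ 2).toNNReal : ENNReal)) :=
    isFiniteMeasure_withDensity_ofReal hint.2
  refine ext_of_forall_integral_eq_of_IsFiniteMeasure fun g => ?_
  rw [integral_withDensity_eq_integral_smul hm]
  have hg : Φ (g.toContinuousMap * q) (Φ q u) = Φ (g.toContinuousMap * q * q) u := by
    rw [map_mul Φ (g.toContinuousMap * q) q]
    rfl
  calc ∫ x, g x ∂ν = (inner ℂ (Φ g.toContinuousMap v) v).re := hν g.toContinuousMap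
    _ = (inner ℂ (Φ (g.toContinuousMap * q * q) u) u).re := by
        rw [← hq, inner_functionalCalculus_mul hΦ, hg]
    _ = ∫ x, (g.toContinuousMap * q * q) x ∂ρ := (hρ _).symm
    _ = ∫ x, (q x ^ 2).toNNReal • g x ∂ρ := by
        congr 1
        ext x
        change g x * q x * q x = ((q x ^ 2).toNNReal : ℝ) * g x
        rw [Real.coe_toNNReal _ (sq_nonneg _)]
        ring

theorem integral_withDensity_sq_eq {q h : C(X, ℝ)} {f : X → ℝ}
    (hf : ∀ x, q x ^ 2 * f x = h x) :
    Integrable f (ρ.withDensity fun x => ((q x ^ 2).toNNReal : ENNReal)) ∧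
      ∫ x, f x ∂(ρ.withDensity fun x => ((q x ^ 2).toNNReal : ENNReal)) = ∫ x, h x ∂ρ := by
  have hm : Measurable fun x => (q x ^ 2).toNNReal := by
    have := q.continuous.measurable
    fun_prop
  have hsmul : (fun x => (q x ^ 2).toNNReal • f x) = h := by
    ext x
    rw [← hf, NNReal.smul_def, Real.coe_toNNReal _ (sq_nonneg _), smul_eq_mul]
  rw [integrable_withDensity_iff_integrable_smul hm, integral_withDensity_eq_integral_smul hm,
    hsmul]
  exact ⟨h.continuous.integrable_of_hasCompactSupport (HasCompactSupport.of_compactSpace _), rfl⟩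

end SpectralMeasure

section Existence

open ComplexPair

/-- A functional with compatible resolvents is given by a measure on the unit cube in the
reciprocal variables. -/
theorem exists_cube_measure {κ : Type} [Fintype κ] {A : Type} [CommRing A] [Algebra ℝ A]
    {L : A →ₗ[ℝ] ℝ} (hL : ∀ a, 0 ≤ L (a ^ 2)) (s : κ → A) (hs : ∀ j, HasDenseMul L (s j))
    (hle : ∀ j a, L (a ^ 2) ≤ L ((s j * a) ^ 2)) (hpos : ∀ j a, 0 ≤ L (s j * a ^ 2)) :
    ∃ ν : Measure (κ → unitInterval), (∀ᵐ y ∂ν, ∀ j, (y j : ℝ) ≠ 0) ∧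
      ∀ α : κ → ℕ, Integrable (fun y => ∏ j, ((y j : ℝ)⁻¹) ^ α j) ν ∧
        ∫ y, ∏ j, ((y j : ℝ)⁻¹) ^ α j ∂ν = L (∏ j, s j ^ α j) := by
  obtain ⟨H, _, _, _, ι, hdense, hι'⟩ := exists_hilbert_of_preInner (preInnerCore L hL)
  have hι : ∀ p q, inner ℂ (ι p) (ι q) = innerForm L p q := hι'
  choose R hRpos hRle hR using fun j =>
    exists_resolvent hι hdense (hs j) (hle j) (hpos j)
  obtain ⟨Φ, hΦ, hΦR⟩ := exists_cube_functionalCalculus_of_isPositive R hRpos hRle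
    fun i j => resolvent_comm hι hdense (hs i) (hs j) (hR i) (hR j)
  let M : Submonoid (C(κ → unitInterval, ℝ) × A) :=
    { carrier := {z | ∀ p, Φ z.1 (ι (mulLeft z.2 p)) = ι p}
      one_mem' := fun p => by
        change Φ 1 (ι (mulLeft 1 p)) = ι p
        rw [map_one, mulLeft_one]
        rfl
      mul_mem' := fun {z w} hz hw p => by
        change Φ (z.1 * w.1) (ι (mulLeft (z.2 * w.2) p)) = ι p
        rw [mul_comm z.1, map_mul, mulLeft_mul]
        change Φ w.1 (Φ z.1 _) = _
        rw [hz, hw] }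
  have hM : ∀ (α : κ → ℕ) (p : ComplexPair A),
      Φ (∏ j, cubeCoord j ^ α j) (ι (mulLeft (∏ j, s j ^ α j) p)) = ι p := by
    intro α
    have h : (∏ j, ((cubeCoord j, s j) : C(κ → unitInterval, ℝ) × A) ^ α j) ∈ M := by
      refine prod_mem fun j _ => pow_mem (fun p => ?_) _
      change Φ (cubeCoord j) (ι (mulLeft (s j) p)) = ι p
      rw [hΦR, hR]
    have h' : (∏ j, ((cubeCoord j, s j) : C(κ → unitInterval, ℝ) × A) ^ α j) =
        (∏ j, cubeCoord j ^ α j, ∏ j, s j ^ α j) := by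
      ext1 <;> simp [Prod.fst_prod, Prod.snd_prod]
    rw [h'] at h
    exact h
  let e : ComplexPair A := (1, 0)
  obtain ⟨ν, hνfin, hν⟩ := exists_spectralMeasure hΦ (ι e)
  have hkey : ∀ α : κ → ℕ, ∃ ρ : Measure (κ → unitInterval), IsFiniteMeasure ρ ∧
      ν = ρ.withDensity (fun y =>
        (((∏ j, cubeCoord j ^ (α j + 1) : C(κ → unitInterval, ℝ)) y ^ 2).toNNReal : ENNReal)) ∧
      ∫ y, (∏ j, cubeCoord j ^ (α j + 2) : C(κ → unitInterval, ℝ)) y ∂ρ =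
        L (∏ j, s j ^ α j) := by
    intro α
    obtain ⟨ρ, hρfin, hρ⟩ :=
      exists_spectralMeasure hΦ (ι (mulLeft (∏ j, s j ^ (α j + 1)) e))
    refine ⟨ρ, hρfin, spectralMeasure_eq_withDensity hΦ hν hρ (hM _ _), ?_⟩
    have h1 : (∏ j, cubeCoord j ^ (α j + 2) : C(κ → unitInterval, ℝ)) =
        (∏ j, cubeCoord j ^ 1) * ∏ j, cubeCoord j ^ (α j + 1) := by
      rw [← Finset.prod_mul_distrib]
      exact Finset.prod_congr rfl fun j _ => by ring
    have h2 : (∏ j, s j ^ (α j + 1)) = (∏ j, s j ^ 1) * ∏ j, s j ^ α j := by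
      rw [← Finset.prod_mul_distrib]
      exact Finset.prod_congr rfl fun j _ => by ring
    rw [hρ, h1, ← inner_functionalCalculus_mul hΦ, hM]
    rw [h2, mulLeft_mul, hM (fun _ => 1), hι]
    simp only [innerForm, e]
    refine congrArg L ?_
    change (∏ j, s j ^ α j) * 1 * 1 + (∏ j, s j ^ α j) * 0 * 0 = _
    ring
  refine ⟨ν, ?_, fun α => ?_⟩
  · obtain ⟨ρ, hρfin, hρ, -⟩ := hkey 0
    rw [hρ]
    have hm : Measurable fun y : κ → unitInterval =>
        (((∏ j, cubeCoord j ^ ((0 : κ → ℕ) j + 1) : C(κ → unitInterval, ℝ)) y ^ 2).toNNReal :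
          ENNReal) := by
      have :=
        (∏ j, cubeCoord j ^ ((0 : κ → ℕ) j + 1) : C(κ → unitInterval, ℝ)).continuous.measurable
      fun_prop
    rw [ae_withDensity_iff hm]
    refine Filter.Eventually.of_forall fun y hy j hj => hy ?_
    have : (∏ j, cubeCoord j ^ ((0 : κ → ℕ) j + 1) : C(κ → unitInterval, ℝ)) y = 0 := by
      rw [ContinuousMap.prod_apply]
      exact Finset.prod_eq_zero (Finset.mem_univ j) (by simpa [cubeCoord] using hj)
    rw [this]
    simp
  · obtain ⟨ρ, hρfin, hρ, hα⟩ := hkey α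
    rw [hρ, ← hα]
    refine integral_withDensity_sq_eq fun y => ?_
    simp only [ContinuousMap.prod_apply, ContinuousMap.pow_apply, ← Finset.prod_pow,
      ← Finset.prod_mul_distrib]
    refine Finset.prod_congr rfl fun j _ => ?_
    change (((y j : ℝ)) ^ (α j + 1)) ^ 2 * ((y j : ℝ)⁻¹) ^ α j = (y j : ℝ) ^ (α j + 2)
    by_cases h : (y j : ℝ) = 0
    · rw [h]; simp
    · rw [inv_pow]
      field_simp
      ring

variable {d : ℕ} {L : MvPolynomial (Fin d) ℝ →ₗ[ℝ] ℝ}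

theorem hasDenseMul_one_add_X (hsq : ∀ p : MvPolynomial (Fin d) ℝ, 0 ≤ L (p ^ 2))
    (hxsq : ∀ (j : Fin d) (p : MvPolynomial (Fin d) ℝ), 0 ≤ L (X j * p ^ 2)) (j : Fin d)
    (hS : ∑' n : ℕ, (ENNReal.ofReal (L (X j ^ (n + 1)))) ^ (-(1 / (2 * ((n : ℝ) + 1)))) = ⊤) :
    HasDenseMul L (1 + X j) := by
  intro a b ε hε
  obtain ⟨g, hg, -, hL⟩ := exists_small_aeval hsq hxsq j hS a b one_pos hε
  obtain ⟨f, hf⟩ : Polynomial.X - Polynomial.C (-1 : ℝ) ∣ 1 - g :=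
    Polynomial.dvd_iff_isRoot.2 (by simp [hg])
  have hf' := congrArg (Polynomial.aeval (X j : MvPolynomial (Fin d) ℝ)) hf
  simp only [map_sub, map_add, map_one, map_mul, map_neg, sub_neg_eq_add, Polynomial.aeval_X] at hf'
  refine ⟨Polynomial.aeval (X j) f, le_trans (le_of_eq (congrArg L ?_)) hL⟩
  have hg' : Polynomial.aeval (X j : MvPolynomial (Fin d) ℝ) g =
      1 - (1 + X j) * Polynomial.aeval (X j) f := by
    linear_combination -hf'
  rw [hg']
  ring

theorem exists_orthant_measure (hsq : ∀ p : MvPolynomial (Fin d) ℝ, 0 ≤ L (p ^ 2))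
    (hxsq : ∀ (j : Fin d) (p : MvPolynomial (Fin d) ℝ), 0 ≤ L (X j * p ^ 2))
    (hS : ∀ j : Fin d,
      ∑' n : ℕ, (ENNReal.ofReal (L (X j ^ (n + 1)))) ^ (-(1 / (2 * ((n : ℝ) + 1)))) = ⊤) :
    ∃ μ : Measure (Fin d → ℝ), μ {x | ¬ ∀ j : Fin d, 0 ≤ x j} = 0 ∧
      (∀ p : MvPolynomial (Fin d) ℝ, Integrable (fun x => eval x p) μ) ∧
      ∀ p : MvPolynomial (Fin d) ℝ, L p = ∫ x, eval x p ∂μ := by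
  obtain ⟨ν, hν0, hν⟩ := exists_cube_measure hsq (fun j => 1 + X j)
    (fun j => hasDenseMul_one_add_X hsq hxsq j (hS j))
    (fun j a => by
      have h : ((1 + X j) * a) ^ 2 = a ^ 2 + ((2 : ℝ) • (X j * a ^ 2) + (X j * a) ^ 2) := by
        rw [smul_eq_C_mul, show (C 2 : MvPolynomial (Fin d) ℝ) = 2 from map_ofNat C 2]
        ring
      rw [h, map_add, map_add, map_smul]
      have h1 := hxsq j a
      have h2 := hsq (X j * a)
      simp only [smul_eq_mul]
      linarith)
    (fun j a => by
      rw [add_mul, one_mul, map_add]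
      exact add_nonneg (hsq a) (hxsq j a))
  let T : (Fin d → unitInterval) → Fin d → ℝ := fun y j => (y j : ℝ)⁻¹ - 1
  have hT : Measurable T := by
    refine measurable_pi_lambda _ fun j => ?_
    have : Measurable fun y : Fin d → unitInterval => (y j : ℝ) :=
      measurable_subtype_coe.comp (measurable_pi_apply j)
    exact this.inv.sub_const 1
  have hev : ∀ (y : Fin d → unitInterval) (p : MvPolynomial (Fin d) ℝ),
      eval (T y) (bind₁ (fun j => 1 + X j) p) = eval (fun j => (y j : ℝ)⁻¹) p := by
    intro y p
    rw [← MvPolynomial.coe_aeval_eq_eval, ← MvPolynomial.coe_aeval_eq_eval]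
    simp only [RingHom.coe_coe, aeval_bind₁]
    congr 2
    ext j
    simp [T]
  have hshift : ∀ p : MvPolynomial (Fin d) ℝ,
      Integrable (fun y => eval (fun j => (y j : ℝ)⁻¹) p) ν ∧
        ∫ y, eval (fun j => (y j : ℝ)⁻¹) p ∂ν = L (bind₁ (fun j => 1 + X j) p) := by
    intro p
    induction p using MvPolynomial.induction_on' with
    | monomial u a =>
      have h1 : ∀ y : Fin d → unitInterval, eval (fun j => (y j : ℝ)⁻¹) (monomial u a) =
          a * ∏ j, ((y j : ℝ)⁻¹) ^ u j := by
        intro y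
        rw [eval_monomial, Finsupp.prod_fintype _ _ (by simp)]
      have h2 : bind₁ (fun j => 1 + X j) (monomial u a) =
          a • ∏ j, (1 + X j : MvPolynomial (Fin d) ℝ) ^ u j := by
        rw [bind₁_monomial, smul_eq_C_mul]
        congr 1
        exact Finsupp.prod_fintype _ _ (by simp)
      simp only [h1]
      refine ⟨(hν u).1.const_mul a, ?_⟩
      rw [integral_const_mul, (hν u).2, h2, map_smul, smul_eq_mul]
    | add p q hp hq =>
      simp only [map_add]
      exact ⟨hp.1.add hq.1, by rw [integral_add hp.1 hq.1, hp.2, hq.2]⟩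
  have hsurj : ∀ p : MvPolynomial (Fin d) ℝ, ∃ q, bind₁ (fun j => 1 + X j) q = p := by
    intro p
    refine ⟨bind₁ (fun j => X j - 1) p, ?_⟩
    rw [bind₁_bind₁]
    simp [bind₁_X_left]
  refine ⟨ν.map T, ?_, fun p => ?_, fun p => ?_⟩
  · have h : ∀ᵐ x ∂(ν.map T), ∀ j, 0 ≤ x j := by
      rw [ae_map_iff hT.aemeasurable]
      · filter_upwards [hν0] with y hy j
        have h0 : 0 < (y j : ℝ) := lt_of_le_of_ne (y j).2.1 (hy j).symm
        exact sub_nonneg.2 ((one_le_inv₀ h0).2 (y j).2.2)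
      · simp only [Set.ofPred_forall]
        exact MeasurableSet.iInter fun j =>
          measurableSet_le measurable_const (measurable_pi_apply j)
    exact h
  · obtain ⟨q, rfl⟩ := hsurj p
    rw [integrable_map_measure (continuous_eval_left _).aestronglyMeasurable hT.aemeasurable]
    refine (hshift q).1.congr (ae_of_all _ fun y => (hev y q).symm)
  · obtain ⟨q, rfl⟩ := hsurj p
    rw [integral_map hT.aemeasurable (continuous_eval_left _).aestronglyMeasurable, ← (hshift q).2]
    exact integral_congr_ae (ae_of_all _ fun y => (hev y q).symm)

end Existence

/-- Theorem 1 (Stieltjes moment problem on ℝ^d): if a linear functional `L` on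
`ℝ[x₁,…,x_d]` satisfies `L(p²) ≥ 0`, `L(x_j p²) ≥ 0` and the multivariate Stieltjes
condition `∑ₙ L(x_jⁿ)^{-1/(2n)} = +∞` for each `j`, then `L` is a Stieltjes moment
functional with a unique representing measure. -/
theorem stieltjes_moment_problem
    (d : ℕ) (hd : 1 ≤ d)
    (L : MvPolynomial (Fin d) ℝ →ₗ[ℝ] ℝ)
    (hsq : ∀ p : MvPolynomial (Fin d) ℝ, 0 ≤ L (p ^ 2))
    (hxsq : ∀ (j : Fin d) (p : MvPolynomial (Fin d) ℝ), 0 ≤ L (X j * p ^ 2))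
    (hstieltjes : ∀ j : Fin d,
      ∑' n : ℕ,
        (ENNReal.ofReal (L (X j ^ (n + 1)))) ^ (-(1 / (2 * ((n : ℝ) + 1)))) = ⊤) :
    (∃ μ : Measure (Fin d → ℝ),
      μ {x | ¬ ∀ j : Fin d, 0 ≤ x j} = 0 ∧
      (∀ p : MvPolynomial (Fin d) ℝ, Integrable (fun x => eval x p) μ) ∧
      (∀ p : MvPolynomial (Fin d) ℝ, L p = ∫ x, eval x p ∂μ)) ∧
    (∀ μ₁ μ₂ : Measure (Fin d → ℝ),
      (∀ p : MvPolynomial (Fin d) ℝ, Integrable (fun x => eval x p) μ₁) →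
      (∀ p : MvPolynomial (Fin d) ℝ, L p = ∫ x, eval x p ∂μ₁) →
      (∀ p : MvPolynomial (Fin d) ℝ, Integrable (fun x => eval x p) μ₂) →
      (∀ p : MvPolynomial (Fin d) ℝ, L p = ∫ x, eval x p ∂μ₂) →
      μ₁ = μ₂) := by
  exact ⟨exists_orthant_measure hsq hxsq hstieltjes,
    fun _ _ h₁ hr₁ h₂ hr₂ => eq_of_represents hsq hxsq hstieltjes h₁ hr₁ h₂ hr₂⟩
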